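/- arXiv:2305.17915 — 11 statements merged into one kernel-verified Lean document; each statement's English description precedes it below -/
import Mathlib

section
/- Suppose that (i) every ℝ-linear derivation u of R satisfying u({f,g}) = {u(f),g} + {f,u(g)} for all f,g ∈ R is of the form {h,·} for some h ∈ R; (ii) every R-linear map δ: M → M satisfying δ([m,n]₁) = [δ(m),n]₁ + [m,δ(n)]₁ for all m,n ∈ M is of the form [η,·]₁ for some η ∈ M; and (iii) the center Z = {ζ ∈ M : [ζ,m]₁ = 0 for all m ∈ M} is {0}. Then every Poisson derivation of A is Hamiltonian, i.e., the first cohomology of the infinitesimal Poisson algebra A vanishes. -/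
variable {R : Type*} [CommRing R] [Algebra ℝ R]
variable {M : Type*} [AddCommGroup M] [Module R M] [Module ℝ M] [IsScalarTower ℝ R M]

/-- The product of the trivial square-zero extension `A = R ⊕ M`. -/
def amul (a b : R × M) : R × M := (a.1 * b.1, a.1 • b.2 + b.1 • a.2)

/-- The affine bracket on `A = R ⊕ M`. -/
def abr (pb : R → R → R) (lb : M → M → M) (D : R → M → M) (K : R → R → M)
    (a b : R × M) : R × M :=
  (pb a.1 b.1, D a.1 b.2 - D b.1 a.2 + lb a.2 b.2 + K a.1 b.1)

/-- A derivation of the algebra `A = R ⊕ M`: an `ℝ`-linear map satisfying Leibniz. -/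
def IsADeriv (X : R × M → R × M) : Prop :=
  (∀ a b : R × M, X (a + b) = X a + X b) ∧
  (∀ (r : ℝ) (a : R × M), X (r • a) = r • X a) ∧
  (∀ a b : R × M, X (amul a b) = amul (X a) b + amul a (X b))

/-- A Poisson derivation of the infinitesimal Poisson algebra `A`. -/
def IsPoissonDeriv (pb : R → R → R) (lb : M → M → M) (D : R → M → M) (K : R → R → M)
    (X : R × M → R × M) : Prop :=
  IsADeriv X ∧
  ∀ a b : R × M, X (abr pb lb D K a b) = abr pb lb D K (X a) b + abr pb lb D K a (X b)

/-- A Hamiltonian derivation of `A`: of the form `{a, ·}ᵃ`. -/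
def IsHamiltonian (pb : R → R → R) (lb : M → M → M) (D : R → M → M) (K : R → R → M)
    (X : R × M → R × M) : Prop :=
  ∃ a : R × M, ∀ b : R × M, X b = abr pb lb D K a b

/-- An `ℝ`-linear derivation of `R`. -/
def IsRDeriv (u : R → R) : Prop :=
  (∀ f g : R, u (f + g) = u f + u g) ∧
  (∀ (r : ℝ) (f : R), u (r • f) = r • u f) ∧
  (∀ f g : R, u (f * g) = u f * g + f * u g)

/-- A derivation `Q : R → M`: an `ℝ`-linear map with `Q (f*g) = f • Q g + g • Q f`. -/
def IsDerivRM (Q : R → M) : Prop :=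
  (∀ f g : R, Q (f + g) = Q f + Q g) ∧
  (∀ (r : ℝ) (f : R), Q (r • f) = r • Q f) ∧
  (∀ f g : R, Q (f * g) = f • Q g + g • Q f)

/-- A derivative endomorphism of `M` with symbol `u` (an `ℝ`-linear derivation of `R`). -/
def IsDerivEndo (δ : M → M) (u : R → R) : Prop :=
  (∀ m n : M, δ (m + n) = δ m + δ n) ∧
  (∀ (r : ℝ) (m : M), δ (r • m) = r • δ m) ∧
  IsRDeriv u ∧
  (∀ (f : R) (m : M), δ (f • m) = f • δ m + u f • m)

/-- Membership in `𝔐`: `δ` is a derivative endomorphism with symbol `u` which is a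
derivation of `[·,·]₁`, whose symbol is a Poisson derivation of `R`, and for which a
witness derivation `Q̃ : R → M` satisfying conditions (A) and (B) exists. -/
def MemM (pb : R → R → R) (lb : M → M → M) (D : R → M → M) (K : R → R → M)
    (δ : M → M) (u : R → R) : Prop :=
  IsDerivEndo δ u ∧
  (∀ m n : M, δ (lb m n) = lb (δ m) n + lb m (δ n)) ∧
  (∀ f g : R, u (pb f g) = pb (u f) g + pb f (u g)) ∧
  ∃ Qt : R → M, IsDerivRM Qt ∧
    (∀ (f : R) (m : M), D f (δ m) - δ (D f m) + D (u f) m = lb (Qt f) m) ∧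
    (∀ f g : R, δ (K f g) - K (u f) g - K f (u g) =
      -(D f (Qt g) - D g (Qt f) - Qt (pb f g)))

/-- A `∂_D`-cocycle: a derivation `R → M` with values in the center `Z` of `[·,·]₁`
satisfying `D_f (Q g) - D_g (Q f) = Q {f,g}`. -/
def IsCocycle (pb : R → R → R) (lb : M → M → M) (D : R → M → M) (Q : R → M) : Prop :=
  IsDerivRM Q ∧
  (∀ (f : R) (m : M), lb (Q f) m = 0) ∧
  (∀ f g : R, D f (Q g) - D g (Q f) = Q (pb f g))

/-- A `∂_D`-coboundary: `Q f = D_f ζ` for some central `ζ`. -/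
def IsCoboundary (lb : M → M → M) (D : R → M → M) (Q : R → M) : Prop :=
  ∃ ζ : M, (∀ m : M, lb ζ m = 0) ∧ ∀ f : R, Q f = D f ζ

/-- Membership in `𝒞 + Inn`: `δ = D_f + [η,·]₁` for some `f ∈ R`, `η ∈ M`. -/
def MemCInn (lb : M → M → M) (D : R → M → M) (δ : M → M) : Prop :=
  ∃ (f : R) (η : M), ∀ m : M, δ m = D f m + lb η m

/-- Membership in `𝒞 = {D_f : f ∈ R}`. -/
def MemC (D : R → M → M) (δ : M → M) : Prop := ∃ f : R, ∀ m : M, δ m = D f m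

/-- If every Poisson vector field of `R` is Hamiltonian, every `R`-linear derivation of
`(M,[·,·]₁)` is inner, and `(M,[·,·]₁)` is centerless, then every Poisson derivation of
the infinitesimal Poisson algebra `A = R ⊕ M` is Hamiltonian. -/
theorem stmt_0
    (pb : R → R → R)
    (pb_add : ∀ f g h : R, pb (f + g) h = pb f h + pb g h)
    (pb_smul : ∀ (r : ℝ) (f g : R), pb (r • f) g = r • pb f g)
    (pb_skew : ∀ f g : R, pb f g = - pb g f)
    (pb_jacobi : ∀ f g h : R, pb f (pb g h) + pb g (pb h f) + pb h (pb f g) = 0)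
    (pb_leibniz : ∀ f g h : R, pb f (g * h) = pb f g * h + g * pb f h)
    (lb : M → M → M)
    (lb_add : ∀ m n p : M, lb (m + n) p = lb m p + lb n p)
    (lb_smul : ∀ (f : R) (m n : M), lb (f • m) n = f • lb m n)
    (lb_smul' : ∀ (f : R) (m n : M), lb m (f • n) = f • lb m n)
    (lb_skew : ∀ m n : M, lb m n = - lb n m)
    (lb_jacobi : ∀ m n p : M, lb m (lb n p) + lb n (lb p m) + lb p (lb m n) = 0)
    (D : R → M → M)
    (D_add_left : ∀ (f g : R) (m : M), D (f + g) m = D f m + D g m)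
    (D_smul_left : ∀ (r : ℝ) (f : R) (m : M), D (r • f) m = r • D f m)
    (D_add_right : ∀ (f : R) (m n : M), D f (m + n) = D f m + D f n)
    (D_smul_right : ∀ (f : R) (r : ℝ) (m : M), D f (r • m) = r • D f m)
    (D_mul : ∀ (f g : R) (m : M), D (f * g) m = f • D g m + g • D f m)
    (D_leibniz : ∀ (f g : R) (m : M), D f (g • m) = g • D f m + pb f g • m)
    (K : R → R → M)
    (K_add : ∀ f g h : R, K (f + g) h = K f h + K g h)
    (K_smul : ∀ (r : ℝ) (f g : R), K (r • f) g = r • K f g)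
    (K_skew : ∀ f g : R, K f g = - K g f)
    (K_leibniz : ∀ f g h : R, K f (g * h) = g • K f h + h • K f g)
    (PT1 : ∀ (f : R) (m n : M), D f (lb m n) = lb (D f m) n + lb m (D f n))
    (PT2 : ∀ (f g : R) (m : M), D f (D g m) - D g (D f m) - D (pb f g) m = lb (K f g) m)
    (PT3 : ∀ f g h : R,
      (D f (K g h) + K f (pb g h)) + (D g (K h f) + K g (pb h f))
        + (D h (K f g) + K h (pb f g)) = 0)
    (MH : ∀ φ : M → R, (∀ m n : M, φ (m + n) = φ m + φ n) →
      (∀ (f : R) (m : M), φ (f • m) = f * φ m) → (∀ m : M, φ m • m = 0) →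
      ∀ m : M, φ m = 0)
    (faithful : ∀ f : R, (∀ m : M, f • m = 0) → f = 0)
    (h1 : ∀ u : R → R, IsRDeriv u →
      (∀ f g : R, u (pb f g) = pb (u f) g + pb f (u g)) →
      ∃ h : R, ∀ f : R, u f = pb h f)
    (h2 : ∀ δ : M → M, (∀ m n : M, δ (m + n) = δ m + δ n) →
      (∀ (f : R) (m : M), δ (f • m) = f • δ m) →
      (∀ m n : M, δ (lb m n) = lb (δ m) n + lb m (δ n)) →
      ∃ η : M, ∀ m : M, δ m = lb η m)
    (h3 : ∀ ζ : M, (∀ m : M, lb ζ m = 0) → ζ = 0) :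
    ∀ X : R × M → R × M, IsPoissonDeriv pb lb D K X → IsHamiltonian pb lb D K X := by
  have pb_zero_left : ∀ g, pb 0 g = 0 := fun g => by simpa using pb_add 0 0 g
  have pb_zero_right : ∀ f, pb f 0 = 0 := fun f => by rw [pb_skew, pb_zero_left, neg_zero]
  have lb_zero_left : ∀ m, lb 0 m = 0 := fun m => by simpa using lb_add 0 0 m
  have D_zero_left : ∀ m, D 0 m = 0 := fun m => by simpa using D_add_left 0 0 m
  have D_zero_right : ∀ f, D f 0 = 0 := fun f => by simpa using D_add_right f 0 0
  have K_zero_left : ∀ g, K 0 g = 0 := fun g => by simpa using K_add 0 0 g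
  have K_zero_right : ∀ f, K f 0 = 0 := fun f => by rw [K_skew, K_zero_left, neg_zero]
  have lb_add_right : ∀ m n p, lb m (n + p) = lb m n + lb m p := fun m n p => by
    rw [lb_skew, lb_add, lb_skew n, lb_skew p]; abel
  have lb_sub : ∀ m n p, lb (m - n) p = lb m p - lb n p := fun m n p => by
    rw [eq_sub_iff_add_eq, ← lb_add, sub_add_cancel]
  have lb_sub_right : ∀ m n p, lb m (n - p) = lb m n - lb m p := fun m n p => by
    rw [eq_sub_iff_add_eq, ← lb_add_right, sub_add_cancel]
  rintro X ⟨⟨X_add, X_smul, X_mul⟩, X_br⟩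
  -- The off-diagonal component `M → R` of `X` vanishes.
  have φ_zero : ∀ m : M, (X (0, m)).1 = 0 := by
    refine MH (fun m => (X (0, m)).1) (fun m n => ?_) (fun f m => ?_) (fun m => ?_)
    · simpa using congrArg Prod.fst (X_add (0, m) (0, n))
    · simpa [amul] using congrArg Prod.fst (X_mul (f, 0) (0, m))
    · have h := congrArg Prod.snd (X_mul (0, m) (0, m))
      have h0 : X (0, 0) = 0 := by simpa using X_add (0, 0) (0, 0)
      simp only [amul, mul_zero, zero_smul, add_zero, h0, zero_add, Prod.snd_add,
        Prod.snd_zero] at h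
      rw [← two_smul ℝ] at h
      exact (smul_eq_zero_iff_right (two_ne_zero' ℝ)).mp h.symm
  -- The symbol of `X` is a Poisson derivation of `R`, hence Hamiltonian.
  obtain ⟨h, hu⟩ := h1 (fun f => (X (f, 0)).1)
    ⟨fun f g => by simpa using congrArg Prod.fst (X_add (f, 0) (g, 0)),
      fun r f => by simpa using congrArg Prod.fst (X_smul r (f, 0)),
      fun f g => by simpa [amul] using congrArg Prod.fst (X_mul (f, 0) (g, 0))⟩
    (fun f g => by
      have e := congrArg Prod.fst (X_br (f, 0) (g, 0))
      have e' := congrArg Prod.fst (X_add (pb f g, 0) (0, K f g))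
      simp only [Prod.mk_add_mk, add_zero, zero_add, Prod.fst_add, φ_zero] at e'
      simpa [abr, D_zero_right, lb_zero_left, e'] using e)
  have δ_smul : ∀ (f : R) (m : M),
      (X (0, f • m)).2 = f • (X (0, m)).2 + pb h f • m := fun f m => by
    have e := congrArg Prod.snd (X_mul (f, 0) (0, m))
    simp only [← hu]
    simpa [amul, add_comm] using e
  have δ_lb : ∀ m n : M,
      (X (0, lb m n)).2 = lb (X (0, m)).2 n + lb m (X (0, n)).2 := fun m n => by
    have e := congrArg Prod.snd (X_br (0, m) (0, n))
    simpa [abr, φ_zero, D_zero_left, pb_zero_left, K_zero_left] using e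
  obtain ⟨η, hη⟩ := h2 (fun m => (X (0, m)).2 - D h m)
    (fun m n => by
      have e := congrArg Prod.snd (X_add (0, m) (0, n))
      simp only [Prod.mk_add_mk, add_zero, Prod.snd_add] at e
      rw [e, D_add_right]; abel)
    (fun f m => by rw [δ_smul, D_leibniz, smul_sub]; abel)
    (fun m n => by rw [δ_lb, PT1, lb_sub, lb_sub_right]; abel)
  have hδ : ∀ m, (X (0, m)).2 = D h m + lb η m := fun m => by
    rw [← hη]; abel
  -- The component `R → M` is determined up to the center, which is trivial.
  have hQ : ∀ f : R, (X (f, 0)).2 = K h f - D f η := fun f => by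
    rw [← sub_eq_zero]
    refine h3 _ fun m => ?_
    have e := congrArg Prod.snd (X_br (f, 0) (0, m))
    simp only [abr, pb_zero_right, D_zero_right, D_zero_left, lb_zero_left,
      K_zero_right, φ_zero, hδ, hu, Prod.snd_add, sub_zero, add_zero, D_add_right, PT1] at e
    rw [lb_sub, lb_sub, ← PT2]
    refine Eq.trans ?_ (sub_eq_zero.mpr e.symm)
    abel
  refine ⟨(h, η), fun ⟨f, m⟩ => ?_⟩
  have e : X (f, m) = X (f, 0) + X (0, m) := by rw [← X_add]; simp
  rw [e]
  ext
  · simp [abr, φ_zero, hu]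
  · simp only [abr, Prod.snd_add, hQ, hδ]
    abel
end

section
/- Suppose that (i) every ℝ-linear derivation u of R satisfying u({f,g}) = {u(f),g} + {f,u(g)} for all f,g ∈ R is of the form {h,·} for some h ∈ R; (ii) every R-linear map δ: M → M satisfying δ([m,n]₁) = [δ(m),n]₁ + [m,δ(n)]₁ for all m,n ∈ M is of the form [η,·]₁ for some η ∈ M; and (iii) every ∂_D-cocycle is a ∂_D-coboundary. Then every Poisson derivation of A is Hamiltonian, i.e., the first cohomology of the infinitesimal Poisson algebra A vanishes. -/
variable {R : Type*} [CommRing R] [Algebra ℝ R]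
variable {M : Type*} [AddCommGroup M] [Module R M] [Module ℝ M] [IsScalarTower ℝ R M]

/-- If every Poisson vector field of `R` is Hamiltonian, every `R`-linear derivation of
`(M,[·,·]₁)` is inner, and every `∂_D`-cocycle is a `∂_D`-coboundary, then every Poisson
derivation of the infinitesimal Poisson algebra `A = R ⊕ M` is Hamiltonian. -/
theorem stmt_1
    (pb : R → R → R)
    (pb_add : ∀ f g h : R, pb (f + g) h = pb f h + pb g h)
    (pb_smul : ∀ (r : ℝ) (f g : R), pb (r • f) g = r • pb f g)
    (pb_skew : ∀ f g : R, pb f g = - pb g f)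
    (pb_jacobi : ∀ f g h : R, pb f (pb g h) + pb g (pb h f) + pb h (pb f g) = 0)
    (pb_leibniz : ∀ f g h : R, pb f (g * h) = pb f g * h + g * pb f h)
    (lb : M → M → M)
    (lb_add : ∀ m n p : M, lb (m + n) p = lb m p + lb n p)
    (lb_smul : ∀ (f : R) (m n : M), lb (f • m) n = f • lb m n)
    (lb_smul' : ∀ (f : R) (m n : M), lb m (f • n) = f • lb m n)
    (lb_skew : ∀ m n : M, lb m n = - lb n m)
    (lb_jacobi : ∀ m n p : M, lb m (lb n p) + lb n (lb p m) + lb p (lb m n) = 0)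
    (D : R → M → M)
    (D_add_left : ∀ (f g : R) (m : M), D (f + g) m = D f m + D g m)
    (D_smul_left : ∀ (r : ℝ) (f : R) (m : M), D (r • f) m = r • D f m)
    (D_add_right : ∀ (f : R) (m n : M), D f (m + n) = D f m + D f n)
    (D_smul_right : ∀ (f : R) (r : ℝ) (m : M), D f (r • m) = r • D f m)
    (D_mul : ∀ (f g : R) (m : M), D (f * g) m = f • D g m + g • D f m)
    (D_leibniz : ∀ (f g : R) (m : M), D f (g • m) = g • D f m + pb f g • m)
    (K : R → R → M)
    (K_add : ∀ f g h : R, K (f + g) h = K f h + K g h)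
    (K_smul : ∀ (r : ℝ) (f g : R), K (r • f) g = r • K f g)
    (K_skew : ∀ f g : R, K f g = - K g f)
    (K_leibniz : ∀ f g h : R, K f (g * h) = g • K f h + h • K f g)
    (PT1 : ∀ (f : R) (m n : M), D f (lb m n) = lb (D f m) n + lb m (D f n))
    (PT2 : ∀ (f g : R) (m : M), D f (D g m) - D g (D f m) - D (pb f g) m = lb (K f g) m)
    (PT3 : ∀ f g h : R,
      (D f (K g h) + K f (pb g h)) + (D g (K h f) + K g (pb h f))
        + (D h (K f g) + K h (pb f g)) = 0)
    (MH : ∀ φ : M → R, (∀ m n : M, φ (m + n) = φ m + φ n) →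
      (∀ (f : R) (m : M), φ (f • m) = f * φ m) → (∀ m : M, φ m • m = 0) →
      ∀ m : M, φ m = 0)
    (faithful : ∀ f : R, (∀ m : M, f • m = 0) → f = 0)
    (h1 : ∀ u : R → R, IsRDeriv u →
      (∀ f g : R, u (pb f g) = pb (u f) g + pb f (u g)) →
      ∃ h : R, ∀ f : R, u f = pb h f)
    (h2 : ∀ δ : M → M, (∀ m n : M, δ (m + n) = δ m + δ n) →
      (∀ (f : R) (m : M), δ (f • m) = f • δ m) →
      (∀ m n : M, δ (lb m n) = lb (δ m) n + lb m (δ n)) →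
      ∃ η : M, ∀ m : M, δ m = lb η m)
    (h3 : ∀ Q : R → M, IsCocycle pb lb D Q → IsCoboundary lb D Q) :
    ∀ X : R × M → R × M, IsPoissonDeriv pb lb D K X → IsHamiltonian pb lb D K X := by
  rintro X ⟨⟨X_add, X_smul, X_mul⟩, X_br⟩
  have pb_zero_left (f : R) : pb 0 f = 0 := by simpa using pb_add 0 0 f
  have pb_zero_right (f : R) : pb f 0 = 0 := by rw [pb_skew, pb_zero_left, neg_zero]
  have lb_zero_left (m : M) : lb 0 m = 0 := by simpa using lb_add 0 0 m
  have lb_zero_right (m : M) : lb m 0 = 0 := by rw [lb_skew, lb_zero_left, neg_zero]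
  have lb_add_right (m n p : M) : lb m (n + p) = lb m n + lb m p := by
    rw [lb_skew, lb_add, lb_skew n, lb_skew p]; abel
  have lb_neg_left (m n : M) : lb (-m) n = -lb m n := by
    rw [eq_neg_iff_add_eq_zero, ← lb_add, neg_add_cancel, lb_zero_left]
  have D_zero_left (m : M) : D 0 m = 0 := by simpa using D_add_left 0 0 m
  have D_zero_right (f : R) : D f 0 = 0 := by simpa using D_add_right f 0 0
  have D_neg_right (f : R) (m : M) : D f (-m) = -D f m := by
    rw [eq_neg_iff_add_eq_zero, ← D_add_right, neg_add_cancel, D_zero_right]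
  have K_zero_left (f : R) : K 0 f = 0 := by simpa using K_add 0 0 f
  have K_zero_right (f : R) : K f 0 = 0 := by rw [K_skew, K_zero_left, neg_zero]
  have K_neg_left (f g : R) : K (-f) g = -K f g := by
    rw [eq_neg_iff_add_eq_zero, ← K_add, neg_add_cancel, K_zero_left]
  have K_add_right (f g k : R) : K f (g + k) = K f g + K f k := by
    rw [K_skew, K_add, K_skew g, K_skew k]; abel
  have K_neg_right (f g : R) : K f (-g) = -K f g := by
    rw [K_skew, K_neg_left, K_skew g, neg_neg]
  have K_smul_right (r : ℝ) (f g : R) : K f (r • g) = r • K f g := by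
    rw [K_skew, K_smul, K_skew g, smul_neg, neg_neg]
  -- A derivation of `A` maps the ideal `M` to itself.
  have X_M_fst : ∀ m : M, (X (0, m)).1 = 0 := by
    refine MH (fun m ↦ (X (0, m)).1) (fun m n ↦ ?_) (fun f m ↦ ?_) (fun m ↦ ?_)
    · simpa using congrArg Prod.fst (X_add (0, m) (0, n))
    · simpa [amul] using congrArg Prod.fst (X_mul (f, 0) (0, m))
    · have h := congrArg Prod.snd (X_mul (0, m) (0, m))
      have h0 : X 0 = 0 := by simpa using X_smul 0 0
      simp only [amul, mul_zero, zero_smul, add_zero, zero_add, Prod.mk_zero_zero, h0, Prod.snd_add,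
        Prod.snd_zero] at h
      have h' : (2 : ℝ) • ((X (0, m)).1 • m) = 0 := by rw [two_smul]; exact h.symm
      simpa using congrArg (fun x ↦ (2 : ℝ)⁻¹ • x) h'
  obtain ⟨u, hu⟩ : ∃ u : R → R, ∀ f, (X (f, 0)).1 = u f := ⟨_, fun _ ↦ rfl⟩
  obtain ⟨Q, hQ⟩ : ∃ Q : R → M, ∀ f, (X (f, 0)).2 = Q f := ⟨_, fun _ ↦ rfl⟩
  obtain ⟨δ, hδ⟩ : ∃ δ : M → M, ∀ m, (X (0, m)).2 = δ m := ⟨_, fun _ ↦ rfl⟩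
  have X_R (f : R) : X (f, 0) = (u f, Q f) := Prod.ext (hu f) (hQ f)
  have X_M (m : M) : X (0, m) = (0, δ m) := Prod.ext (X_M_fst m) (hδ m)
  have X_eq (f : R) (m : M) : X (f, m) = (u f, Q f + δ m) := by
    simpa [X_R, X_M] using X_add (f, 0) (0, m)
  have δ_add (m n : M) : δ (m + n) = δ m + δ n := by
    simpa [X_M] using X_add (0, m) (0, n)
  have δ_zero : δ 0 = 0 := by simpa using δ_add 0 0
  have hX_add (f g : R) : u (f + g) = u f + u g ∧ Q (f + g) = Q f + Q g := by
    simpa [X_R] using X_add (f, 0) (g, 0)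
  have hX_smul (r : ℝ) (f : R) : u (r • f) = r • u f ∧ Q (r • f) = r • Q f := by
    simpa [X_R] using X_smul r (f, 0)
  have hX_mul (f g : R) : u (f * g) = u f * g + f * u g ∧ Q (f * g) = g • Q f + f • Q g := by
    simpa [amul, X_R] using X_mul (f, 0) (g, 0)
  have δ_smul (f : R) (m : M) : δ (f • m) = u f • m + f • δ m := by
    simpa [amul, X_R, X_M] using X_mul (f, 0) (0, m)
  have δ_lb (m n : M) : δ (lb m n) = lb (δ m) n + lb m (δ n) := by
    simpa [abr, X_M, pb_zero_left, D_zero_left, K_zero_left] using X_br (0, m) (0, n)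
  have δ_D (f : R) (m : M) : δ (D f m) = D (u f) m + lb (Q f) m + D f (δ m) := by
    simpa [abr, X_R, X_M, pb_zero_right, D_zero_left, K_zero_right, lb_zero_left]
      using X_br (f, 0) (0, m)
  have hX_br (f g : R) : u (pb f g) = pb (u f) g + pb f (u g) ∧
      Q (pb f g) + δ (K f g) = -D g (Q f) + K (u f) g + (D f (Q g) + K f (u g)) := by
    simpa [abr, X_eq, δ_zero, D_zero_right, lb_zero_left, lb_zero_right] using X_br (f, 0) (g, 0)
  obtain ⟨h, u_eq⟩ := h1 u
    ⟨fun f g ↦ (hX_add f g).1, fun r f ↦ (hX_smul r f).1, fun f g ↦ (hX_mul f g).1⟩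
    (fun f g ↦ (hX_br f g).1)
  obtain ⟨η, hη⟩ := h2 (fun m ↦ δ m - D h m)
    (fun m n ↦ by simp only [δ_add, D_add_right]; abel)
    (fun f m ↦ by simp only [δ_smul, D_leibniz, u_eq, smul_sub]; abel)
    (fun m n ↦ by
      simp only [δ_lb, PT1, sub_eq_add_neg, lb_add, lb_add_right, lb_neg_left]
      rw [lb_skew m (-D h n), lb_neg_left, lb_skew m (D h n)]
      abel)
  have δ_eq (m : M) : δ m = D h m + lb η m := by rw [← hη]; abel
  obtain ⟨ζ, ζ_central, hζ⟩ := h3 (fun f ↦ Q f - K h f + D f η) <| by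
    refine ⟨⟨fun f g ↦ ?_, fun r f ↦ ?_, fun f g ↦ ?_⟩, fun f m ↦ ?_, fun f g ↦ ?_⟩
    · simp only [(hX_add f g).2, K_add_right, D_add_left]; abel
    · simp only [(hX_smul r f).2, K_smul_right, D_smul_left, smul_add, smul_sub]
    · simp only [(hX_mul f g).2, K_leibniz, D_mul, smul_add, smul_sub]; abel
    · have e := δ_D f m
      have e' := PT2 h f m
      simp only [δ_eq, u_eq, D_add_right, PT1] at e
      simp only [sub_eq_add_neg, lb_add, lb_neg_left] at e' ⊢
      rw [← e']
      linear_combination (norm := module) -e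
    · have e := (hX_br f g).2
      have e₂ := PT2 f g η
      have e₃ := PT3 h f g
      rw [lb_skew] at e₂
      simp only [δ_eq, u_eq] at e
      rw [K_skew (pb h f) g] at e
      rw [pb_skew g h, K_neg_right, K_skew g h, D_neg_right] at e₃
      simp only [sub_eq_add_neg, D_add_right, D_neg_right] at e₂ ⊢
      linear_combination (norm := module) e₂ + e₃ - e
  refine ⟨(h, η - ζ), fun ⟨f, m⟩ ↦ ?_⟩
  have e := hζ f
  simp only [X_eq, abr, u_eq, δ_eq, sub_eq_add_neg, D_add_right, D_neg_right, lb_add,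
    lb_neg_left, ζ_central, Prod.mk.injEq, true_and] at e ⊢
  linear_combination (norm := module) e
end

section
/- Let H¹(𝒫) denote the quotient ℝ-vector space of Poisson derivations of A modulo Hamiltonian derivations, and let H¹_{∂_D} denote the quotient of ∂_D-cocycles modulo ∂_D-coboundaries. Then the assignment Q ↦ X_Q induces a well-defined ℝ-linear map J: H¹_{∂_D} → H¹(𝒫), the assignment X = X_δ + X_Q ↦ δ induces a well-defined surjective ℝ-linear map p: H¹(𝒫) → 𝔐/(𝒞 + Inn), and the resulting sequence 0 → H¹_{∂_D}/ker J → H¹(𝒫) → 𝔐/(𝒞 + Inn) → 0 is exact: the map induced by J is injective and its image equals the kernel of p. -/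
variable {R : Type*} [CommRing R] [Algebra ℝ R]
variable {M : Type*} [AddCommGroup M] [Module R M] [Module ℝ M] [IsScalarTower ℝ R M]

/-- All the structure maps of the affine bracket are additive in each argument. -/
structure BracketBiadditive (pb : R → R → R) (lb : M → M → M) (D : R → M → M)
    (K : R → R → M) : Prop where
  pb_left : ∀ f g h : R, pb (f + g) h = pb f h + pb g h
  pb_right : ∀ f g h : R, pb f (g + h) = pb f g + pb f h
  lb_left : ∀ m n p : M, lb (m + n) p = lb m p + lb n p
  lb_right : ∀ m n p : M, lb m (n + p) = lb m n + lb m p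
  D_left : ∀ (f g : R) (m : M), D (f + g) m = D f m + D g m
  D_right : ∀ (f : R) (m n : M), D f (m + n) = D f m + D f n
  K_left : ∀ f g h : R, K (f + g) h = K f h + K g h
  K_right : ∀ f g h : R, K f (g + h) = K f g + K f h

theorem map_zero_of_map_add {G H : Type*} [AddGroup G] [AddGroup H] {φ : G → H}
    (h : ∀ a b, φ (a + b) = φ a + φ b) : φ 0 = 0 :=
  (AddMonoidHom.mk' φ h).map_zero

theorem map_neg_of_map_add {G H : Type*} [AddGroup G] [AddGroup H] {φ : G → H}
    (h : ∀ a b, φ (a + b) = φ a + φ b) (a : G) : φ (-a) = -φ a :=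
  (AddMonoidHom.mk' φ h).map_neg a

theorem map_sub_of_map_add {G H : Type*} [AddGroup G] [AddGroup H] {φ : G → H}
    (h : ∀ a b, φ (a + b) = φ a + φ b) (a b : G) : φ (a - b) = φ a - φ b :=
  (AddMonoidHom.mk' φ h).map_sub a b

theorem IsDerivRM.neg {Q : R → M} (hQ : IsDerivRM Q) : IsDerivRM (fun f => -Q f) := by
  obtain ⟨h₁, h₂, h₃⟩ := hQ
  refine ⟨fun f g => ?_, fun r f => ?_, fun f g => ?_⟩
  · simp only [h₁]; abel
  · simp only [h₂, smul_neg]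
  · simp only [h₃, smul_neg]; abel

theorem IsDerivRM.add {Q Q' : R → M} (hQ : IsDerivRM Q) (hQ' : IsDerivRM Q') :
    IsDerivRM (fun f => Q f + Q' f) := by
  obtain ⟨h₁, h₂, h₃⟩ := hQ
  obtain ⟨k₁, k₂, k₃⟩ := hQ'
  refine ⟨fun f g => ?_, fun r f => ?_, fun f g => ?_⟩
  · simp only [h₁, k₁]; abel
  · simp only [h₂, k₂, smul_add]
  · simp only [h₃, k₃, smul_add]; abel

/-- The zero map is a derivative endomorphism with zero symbol. -/
theorem isDerivEndo_zero : IsDerivEndo (fun _ : M => (0 : M)) (fun _ : R => (0 : R)) := by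
  refine ⟨?_, ?_, ⟨?_, ?_, ?_⟩, ?_⟩ <;> simp

/-- `X_δ + X_Q` is a derivation of the square-zero extension. -/
theorem IsDerivEndo.isADeriv {δ : M → M} {u : R → R} {Q : R → M} {X : R × M → R × M}
    (hδ : IsDerivEndo δ u) (hQ : IsDerivRM Q)
    (hX : ∀ a : R × M, X a = (u a.1, δ a.2 + Q a.1)) : IsADeriv X := by
  obtain ⟨δ_add, δ_smul, ⟨u_add, u_smul, u_mul⟩, δ_leib⟩ := hδ
  obtain ⟨Q_add, Q_smul, Q_mul⟩ := hQ
  refine ⟨fun a b => ?_, fun r a => ?_, fun a b => ?_⟩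
  · simp only [hX, Prod.fst_add, Prod.snd_add, δ_add, u_add, Q_add, Prod.mk_add_mk]
    congr 1; abel
  · simp only [hX, Prod.smul_fst, Prod.smul_snd, δ_smul, u_smul, Q_smul, Prod.smul_mk, smul_add]
  · simp only [hX, amul, δ_add, δ_leib, u_mul, Q_mul, Prod.mk_add_mk, smul_add]
    refine Prod.ext (by ring) ?_
    dsimp only
    abel

/-- A derivation of the square-zero extension preserves the ideal `M` and therefore
splits as `X_δ + X_Q`. -/
theorem IsADeriv.exists_decomposition {X : R × M → R × M} (hX : IsADeriv X)
    (MH : ∀ φ : M → R, (∀ m n : M, φ (m + n) = φ m + φ n) →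
      (∀ (f : R) (m : M), φ (f • m) = f * φ m) → (∀ m : M, φ m • m = 0) →
      ∀ m : M, φ m = 0) :
    ∃ (δ : M → M) (u : R → R) (Q : R → M), IsDerivEndo δ u ∧ IsDerivRM Q ∧
      ∀ a : R × M, X a = (u a.1, δ a.2 + Q a.1) := by
  obtain ⟨X_add, X_smul, X_mul⟩ := hX
  have X_zero : X 0 = 0 := map_zero_of_map_add X_add
  have add_M (m n : M) : X (0, m + n) = X (0, m) + X (0, n) := by rw [← X_add]; simp
  have add_R (f g : R) : X (f + g, 0) = X (f, 0) + X (g, 0) := by rw [← X_add]; simp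
  have smul_M (f : R) (m : M) :
      X (0, f • m) = amul (X (f, 0)) (0, m) + amul (f, 0) (X (0, m)) := by
    rw [← X_mul]; simp [amul]
  have mul_R (f g : R) : X (f * g, 0) = amul (X (f, 0)) (g, 0) + amul (f, 0) (X (g, 0)) := by
    rw [← X_mul]; simp [amul]
  have mul_M (m : M) : (X (0, m)).1 • m + (X (0, m)).1 • m = 0 := by
    have h := X_mul (0, m) (0, m)
    have h0 : amul ((0 : R), m) (0, m) = 0 := by simp [amul]
    rw [h0, X_zero] at h
    simpa [amul] using (congrArg Prod.snd h).symm
  have fst_M : ∀ m : M, (X (0, m)).1 = 0 := by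
    refine MH _ (fun m n => by simp [add_M]) (fun f m => by simp [smul_M, amul])
      fun m => ?_
    have h := mul_M m
    rw [← two_smul ℝ] at h
    exact (smul_eq_zero_iff_right two_ne_zero).1 h
  refine ⟨fun m => (X (0, m)).2, fun f => (X (f, 0)).1, fun f => (X (f, 0)).2,
    ⟨fun m n => by simp [add_M], fun r m => ?_, ⟨fun f g => by simp [add_R],
      fun r f => ?_, fun f g => ?_⟩, fun f m => ?_⟩,
    ⟨fun f g => by simp [add_R], fun r f => ?_, fun f g => ?_⟩, fun a => ?_⟩
  · rw [← Prod.smul_snd, ← X_smul]; simp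
  · rw [← Prod.smul_fst, ← X_smul]; simp
  · simp [mul_R, amul]
  · simp [smul_M, amul, add_comm]
  · rw [← Prod.smul_snd, ← X_smul]; simp
  · simp [mul_R, amul, add_comm]
  · have h : a = (a.1, 0) + (0, a.2) := by simp
    conv_lhs => rw [h, X_add]
    ext <;> simp [fst_M, add_comm]

/-- The derivation `X_δ + X_Q` preserves the affine bracket iff `δ ∈ 𝔐` with witness `-Q`. -/
theorem isPoissonDeriv_iff {pb : R → R → R} {lb : M → M → M} {D : R → M → M} {K : R → R → M}
    (H : BracketBiadditive pb lb D K) {δ : M → M} {u : R → R} {Q : R → M}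
    {X : R × M → R × M} (lb_skew : ∀ m n : M, lb m n = -lb n m)
    (hδ : IsDerivEndo δ u) (hQ : IsDerivRM Q)
    (hX : ∀ a : R × M, X a = (u a.1, δ a.2 + Q a.1)) :
    IsPoissonDeriv pb lb D K X ↔
      (∀ m n : M, δ (lb m n) = lb (δ m) n + lb m (δ n)) ∧
      (∀ f g : R, u (pb f g) = pb (u f) g + pb f (u g)) ∧
      (∀ (f : R) (m : M), D f (δ m) - δ (D f m) + D (u f) m = -lb (Q f) m) ∧
      (∀ f g : R, δ (K f g) - K (u f) g - K f (u g) =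
        D f (Q g) - D g (Q f) - Q (pb f g)) := by
  have δ_add := hδ.1
  have δ_zero : δ 0 = 0 := map_zero_of_map_add δ_add
  have u_zero : u 0 = 0 := map_zero_of_map_add hδ.2.2.1.1
  have Q_zero : Q 0 = 0 := map_zero_of_map_add hQ.1
  have δ_sub := map_sub_of_map_add δ_add
  have pb_zero_left g : pb 0 g = 0 := map_zero_of_map_add (φ := (pb · g)) (H.pb_left · · g)
  have pb_zero_right f : pb f 0 = 0 := map_zero_of_map_add (H.pb_right f)
  have lb_zero_left m : lb 0 m = 0 := map_zero_of_map_add (φ := (lb · m)) (H.lb_left · · m)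
  have lb_zero_right m : lb m 0 = 0 := map_zero_of_map_add (H.lb_right m)
  have D_zero_left m : D 0 m = 0 := map_zero_of_map_add (φ := (D · m)) (H.D_left · · m)
  have D_zero_right f : D f 0 = 0 := map_zero_of_map_add (H.D_right f)
  have K_zero_left g : K 0 g = 0 := map_zero_of_map_add (φ := (K · g)) (H.K_left · · g)
  have K_zero_right f : K f 0 = 0 := map_zero_of_map_add (H.K_right f)
  constructor
  · rintro ⟨-, hb⟩
    refine ⟨fun m n => ?_, fun f g => ?_, fun f m => ?_, fun f g => ?_⟩
    · simpa [hX, abr, pb_zero_left, D_zero_left, K_zero_left, Q_zero, u_zero] using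
        congrArg Prod.snd (hb (0, m) (0, n))
    · simpa [hX, abr] using congrArg Prod.fst (hb (f, 0) (g, 0))
    · have h := congrArg Prod.snd (hb (f, 0) (0, m))
      simp only [hX, abr, Prod.snd_add, δ_zero, u_zero, Q_zero, pb_zero_right, lb_zero_left,
        D_zero_left, K_zero_right, add_zero, zero_add, sub_zero] at h
      linear_combination (norm := abel) -h
    · have h := congrArg Prod.snd (hb (f, 0) (g, 0))
      simp only [hX, abr, Prod.snd_add, δ_zero, lb_zero_left, lb_zero_right,
        D_zero_right, add_zero, zero_add, sub_zero, zero_sub] at h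
      linear_combination (norm := abel) h
  · rintro ⟨h_lb, h_pb, h_D, h_K⟩
    refine ⟨hδ.isADeriv hQ hX, fun ⟨f, m⟩ ⟨g, n⟩ => ?_⟩
    simp only [hX, abr, Prod.mk_add_mk, δ_add, δ_sub, H.D_right, H.lb_left, H.lb_right, h_pb,
      h_lb]
    refine Prod.ext rfl ?_
    have h₁ := h_D f n
    have h₂ := h_D g m
    have h₃ := h_K f g
    rw [lb_skew m (Q g)]
    dsimp only
    linear_combination (norm := abel) h₃ - h₁ + h₂

/-- The short exact sequence `0 → H¹_{∂_D}/ker J → H¹(𝒫) → 𝔐/(𝒞 + Inn) → 0`,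
formulated at the level of representatives: `J : [Q] ↦ [X_Q]` is well defined,
`p : [X = X_δ + X_Q] ↦ [δ]` is well defined and surjective, the image of `J` equals
the kernel of `p`, and the map induced by `J` on `H¹_{∂_D}/ker J` is injective. -/
theorem stmt_2
    (pb : R → R → R)
    (pb_add : ∀ f g h : R, pb (f + g) h = pb f h + pb g h)
    (pb_smul : ∀ (r : ℝ) (f g : R), pb (r • f) g = r • pb f g)
    (pb_skew : ∀ f g : R, pb f g = - pb g f)
    (pb_jacobi : ∀ f g h : R, pb f (pb g h) + pb g (pb h f) + pb h (pb f g) = 0)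
    (pb_leibniz : ∀ f g h : R, pb f (g * h) = pb f g * h + g * pb f h)
    (lb : M → M → M)
    (lb_add : ∀ m n p : M, lb (m + n) p = lb m p + lb n p)
    (lb_smul : ∀ (f : R) (m n : M), lb (f • m) n = f • lb m n)
    (lb_smul' : ∀ (f : R) (m n : M), lb m (f • n) = f • lb m n)
    (lb_skew : ∀ m n : M, lb m n = - lb n m)
    (lb_jacobi : ∀ m n p : M, lb m (lb n p) + lb n (lb p m) + lb p (lb m n) = 0)
    (D : R → M → M)
    (D_add_left : ∀ (f g : R) (m : M), D (f + g) m = D f m + D g m)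
    (D_smul_left : ∀ (r : ℝ) (f : R) (m : M), D (r • f) m = r • D f m)
    (D_add_right : ∀ (f : R) (m n : M), D f (m + n) = D f m + D f n)
    (D_smul_right : ∀ (f : R) (r : ℝ) (m : M), D f (r • m) = r • D f m)
    (D_mul : ∀ (f g : R) (m : M), D (f * g) m = f • D g m + g • D f m)
    (D_leibniz : ∀ (f g : R) (m : M), D f (g • m) = g • D f m + pb f g • m)
    (K : R → R → M)
    (K_add : ∀ f g h : R, K (f + g) h = K f h + K g h)
    (K_smul : ∀ (r : ℝ) (f g : R), K (r • f) g = r • K f g)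
    (K_skew : ∀ f g : R, K f g = - K g f)
    (K_leibniz : ∀ f g h : R, K f (g * h) = g • K f h + h • K f g)
    (PT1 : ∀ (f : R) (m n : M), D f (lb m n) = lb (D f m) n + lb m (D f n))
    (PT2 : ∀ (f g : R) (m : M), D f (D g m) - D g (D f m) - D (pb f g) m = lb (K f g) m)
    (PT3 : ∀ f g h : R,
      (D f (K g h) + K f (pb g h)) + (D g (K h f) + K g (pb h f))
        + (D h (K f g) + K h (pb f g)) = 0)
    (MH : ∀ φ : M → R, (∀ m n : M, φ (m + n) = φ m + φ n) →
      (∀ (f : R) (m : M), φ (f • m) = f * φ m) → (∀ m : M, φ m • m = 0) →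
      ∀ m : M, φ m = 0)
    (faithful : ∀ f : R, (∀ m : M, f • m = 0) → f = 0)
    :
    -- J is well defined: cocycles give Poisson derivations …
    (∀ Q : R → M, IsCocycle pb lb D Q →
      IsPoissonDeriv pb lb D K (fun a : R × M => ((0 : R), Q a.1))) ∧
    -- … and coboundaries give Hamiltonian derivations
    (∀ Q : R → M, IsDerivRM Q → IsCoboundary lb D Q →
      IsHamiltonian pb lb D K (fun a : R × M => ((0 : R), Q a.1))) ∧
    -- p is well defined: every Poisson derivation decomposes as X_δ + X_Q with δ ∈ 𝔐 …
    (∀ X : R × M → R × M, IsPoissonDeriv pb lb D K X →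
      ∃ (δ : M → M) (u : R → R) (Q : R → M), IsDerivRM Q ∧ MemM pb lb D K δ u ∧
        ∀ a : R × M, X a = (u a.1, δ a.2 + Q a.1)) ∧
    -- … and Hamiltonian derivations have δ-part in 𝒞 + Inn
    (∀ (X : R × M → R × M) (δ : M → M) (u : R → R) (Q : R → M),
      IsHamiltonian pb lb D K X → IsDerivEndo δ u → IsDerivRM Q →
      (∀ a : R × M, X a = (u a.1, δ a.2 + Q a.1)) → MemCInn lb D δ) ∧
    -- p is surjective
    (∀ (δ : M → M) (u : R → R), MemM pb lb D K δ u →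
      ∃ (X : R × M → R × M) (Q : R → M), IsPoissonDeriv pb lb D K X ∧ IsDerivRM Q ∧
        ∀ a : R × M, X a = (u a.1, δ a.2 + Q a.1)) ∧
    -- the image of J is contained in the kernel of p
    (∀ (Q : R → M) (δ : M → M) (u : R → R) (Q' : R → M),
      IsCocycle pb lb D Q → IsDerivEndo δ u → IsDerivRM Q' →
      (∀ a : R × M, (((0 : R), Q a.1) : R × M) = (u a.1, δ a.2 + Q' a.1)) →
      MemCInn lb D δ) ∧
    -- the kernel of p is contained in the image of J
    (∀ (X : R × M → R × M) (δ : M → M) (u : R → R) (Q : R → M),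
      IsPoissonDeriv pb lb D K X → IsDerivEndo δ u → IsDerivRM Q →
      (∀ a : R × M, X a = (u a.1, δ a.2 + Q a.1)) → MemCInn lb D δ →
      ∃ Q0 : R → M, IsCocycle pb lb D Q0 ∧
        IsHamiltonian pb lb D K (fun a : R × M => X a - ((0 : R), Q0 a.1))) ∧
    -- the induced map H¹_{∂_D}/ker J → H¹(𝒫) is injective
    (∀ Q Q' : R → M, IsCocycle pb lb D Q → IsCocycle pb lb D Q' →
      IsHamiltonian pb lb D K (fun a : R × M => ((0 : R), Q a.1 - Q' a.1)) →
      ∃ Q0 : R → M, IsCocycle pb lb D Q0 ∧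
        IsHamiltonian pb lb D K (fun a : R × M => ((0 : R), Q0 a.1)) ∧
        IsCoboundary lb D (fun f => Q f - Q' f - Q0 f)) := by
  have pb_right (f g h : R) : pb f (g + h) = pb f g + pb f h := by
    rw [pb_skew, pb_add, pb_skew g, pb_skew h]; abel
  have lb_right (m n p : M) : lb m (n + p) = lb m n + lb m p := by
    rw [lb_skew, lb_add, lb_skew n, lb_skew p]; abel
  have K_right (f g h : R) : K f (g + h) = K f g + K f h := by
    rw [K_skew, K_add, K_skew g, K_skew h]; abel
  have H : BracketBiadditive pb lb D K :=
    ⟨pb_add, pb_right, lb_add, lb_right, D_add_left, D_add_right, K_add, K_right⟩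
  have pb_zero_left g : pb 0 g = 0 := map_zero_of_map_add (φ := (pb · g)) (pb_add · · g)
  have lb_zero_left m : lb 0 m = 0 := map_zero_of_map_add (φ := (lb · m)) (lb_add · · m)
  have lb_neg_left (m n : M) : lb (-m) n = -lb m n :=
    map_neg_of_map_add (φ := (lb · n)) (lb_add · · n) m
  have D_zero_left m : D 0 m = 0 := map_zero_of_map_add (φ := (D · m)) (D_add_left · · m)
  have D_zero_right f : D f 0 = 0 := map_zero_of_map_add (D_add_right f)
  have D_neg_right f m : D f (-m) = -D f m := map_neg_of_map_add (D_add_right f) m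
  have D_sub_right f m n : D f (m - n) = D f m - D f n :=
    map_sub_of_map_add (D_add_right f) m n
  have K_zero_left g : K 0 g = 0 := map_zero_of_map_add (φ := (K · g)) (K_add · · g)
  have K_zero_right f : K f 0 = 0 := map_zero_of_map_add (K_right f)
  have lb_zero_right m : lb m 0 = 0 := map_zero_of_map_add (lb_right m)
  refine ⟨?_, ?_, ?_, ?_, ?_, ?_, ?_, ?_⟩
  · rintro Q ⟨hQ, hZ, hQD⟩
    refine (isPoissonDeriv_iff H lb_skew isDerivEndo_zero hQ fun a => by simp).2
      ⟨fun m n => ?_, fun f g => ?_, fun f m => ?_, fun f g => ?_⟩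
    · simp [lb_zero_left, lb_zero_right]
    · simp [pb_zero_left, pb_skew f 0]
    · simp [D_zero_left, D_zero_right, hZ]
    · simp [K_zero_left, K_zero_right, hQD]
  · rintro Q - ⟨ζ, hζ, hQ⟩
    refine ⟨(0, -ζ), fun b => ?_⟩
    simp [abr, pb_zero_left, D_zero_left, D_neg_right, lb_neg_left, hζ, K_zero_left, hQ]
  · intro X hX
    obtain ⟨δ, u, Q, hδ, hQ, hXeq⟩ := hX.1.exists_decomposition MH
    obtain ⟨h_lb, h_pb, h_D, h_K⟩ := (isPoissonDeriv_iff H lb_skew hδ hQ hXeq).1 hX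
    refine ⟨δ, u, Q, hQ, ⟨hδ, h_lb, h_pb, fun f => -Q f, hQ.neg, fun f m => ?_, fun f g => ?_⟩,
      hXeq⟩
    · rw [h_D, lb_neg_left]
    · simp only [h_K, D_neg_right]; abel
  · rintro X δ u Q ⟨⟨f, η⟩, ha⟩ - hQ hX
    refine ⟨f, η, fun m => ?_⟩
    have h := congrArg Prod.snd ((hX (0, m)).symm.trans (ha (0, m)))
    simpa [abr, map_zero_of_map_add hQ.1, D_zero_left, K_zero_right] using h
  · rintro δ u ⟨hδ, h_lb, h_pb, Qt, hQt, hA, hB⟩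
    refine ⟨fun a => (u a.1, δ a.2 + -Qt a.1), fun f => -Qt f,
      (isPoissonDeriv_iff H lb_skew hδ hQt.neg fun _ => rfl).2
        ⟨h_lb, h_pb, fun f m => ?_, fun f g => ?_⟩, hQt.neg, fun _ => rfl⟩
    · rw [hA, lb_neg_left, neg_neg]
    · rw [hB, D_neg_right, D_neg_right]; abel
  · rintro Q δ u Q' ⟨hQ, -, -⟩ - hQ' hX
    refine ⟨0, 0, fun m => ?_⟩
    have h := congrArg Prod.snd (hX (0, m))
    simp only [map_zero_of_map_add hQ.1, map_zero_of_map_add hQ'.1, add_zero] at h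
    rw [← h, D_zero_left, lb_zero_left, add_zero]
  · rintro X δ u Q hXP hδ hQ hX ⟨f, η, hfη⟩
    obtain ⟨h_lb, h_pb, h_D, h_K⟩ := (isPoissonDeriv_iff H lb_skew hδ hQ hX).1 hXP
    have hu (g : R) : u g = pb f g := by
      refine sub_eq_zero.1 (faithful _ fun m => ?_)
      have h := hδ.2.2.2 g m
      rw [hfη, hfη, D_leibniz, lb_smul', smul_add] at h
      rw [sub_smul]
      linear_combination (norm := abel) -h
    refine ⟨fun g => Q g + (D g η + -K f g), ⟨hQ.add (.add ?_ (.neg ?_)), fun g m => ?_,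
      fun g h => ?_⟩, ⟨(f, η), fun b => ?_⟩⟩
    · exact ⟨fun g h => D_add_left g h η, fun r g => D_smul_left r g η, fun g h => D_mul g h η⟩
    · refine ⟨K_right f, fun r g => ?_, K_leibniz f⟩
      rw [K_skew, K_smul, K_skew g, smul_neg, neg_neg]
    · have h₁ := h_D g m
      have h₂ := PT2 f g m
      rw [hfη, hfη, hu, D_add_right, PT1] at h₁
      rw [lb_add, lb_add, lb_neg_left]
      linear_combination (norm := abel) h₁ + h₂
    · have h₁ := h_K g h
      have h₂ := PT2 g h η
      have h₃ := PT3 f g h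
      rw [hfη, hu, hu, K_skew (pb f g)] at h₁
      rw [pb_skew h f, K_skew h f, D_neg_right,
        map_neg_of_map_add (K_right g)] at h₃
      rw [lb_skew] at h₂
      simp only [D_add_right, D_neg_right]
      linear_combination (norm := abel) -h₁ + h₂ + h₃
    · refine Prod.ext ?_ ?_
      · simp [hX, abr, hu]
      · simp only [hX, abr, hfη, Prod.snd_sub]; abel
  · rintro Q Q' ⟨hQ, hZ, hQD⟩ ⟨hQ', hZ', hQD'⟩ hH
    refine ⟨fun f => Q f - Q' f, ⟨?_, fun f m => ?_, fun f g => ?_⟩, hH, 0, lb_zero_left,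
      fun f => ?_⟩
    · simpa only [sub_eq_add_neg] using hQ.add hQ'.neg
    · simp only [sub_eq_add_neg]
      rw [lb_add, lb_neg_left, hZ, hZ', neg_zero, add_zero]
    · simp only [D_sub_right, ← hQD, ← hQD']; abel
    · simp only [sub_self, D_zero_right]
end

section
/- The sequence of ℝ-linear maps 0 → 𝔐₀/(𝒞₀ + Inn) → 𝔐/(𝒞 + Inn) → σ(𝔐)/Ham(R) → 0, in which the first map is induced by the inclusion 𝔐₀ ⊆ 𝔐 and the second map is induced by the symbol map δ ↦ σ(δ), is well defined and exact: the first map is injective, its image equals the kernel of the second map, and the second map is surjective. -/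
variable {R : Type*} [CommRing R] [Algebra ℝ R]
variable {M : Type*} [AddCommGroup M] [Module R M] [Module ℝ M] [IsScalarTower ℝ R M]

/-- The endomorphism `D_f` lies in `𝔐`, with symbol `{f,·}` and witness `K(·,f)`. -/
theorem memM_D
    {pb : R → R → R}
    (pb_add : ∀ f g h : R, pb (f + g) h = pb f h + pb g h)
    (pb_smul : ∀ (r : ℝ) (f g : R), pb (r • f) g = r • pb f g)
    (pb_skew : ∀ f g : R, pb f g = - pb g f)
    (pb_jacobi : ∀ f g h : R, pb f (pb g h) + pb g (pb h f) + pb h (pb f g) = 0)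
    (pb_leibniz : ∀ f g h : R, pb f (g * h) = pb f g * h + g * pb f h)
    {lb : M → M → M}
    (lb_smul : ∀ (f : R) (m n : M), lb (f • m) n = f • lb m n)
    {D : R → M → M}
    (D_add_right : ∀ (f : R) (m n : M), D f (m + n) = D f m + D f n)
    (D_smul_right : ∀ (f : R) (r : ℝ) (m : M), D f (r • m) = r • D f m)
    (D_leibniz : ∀ (f g : R) (m : M), D f (g • m) = g • D f m + pb f g • m)
    {K : R → R → M}
    (K_add : ∀ f g h : R, K (f + g) h = K f h + K g h)
    (K_smul : ∀ (r : ℝ) (f g : R), K (r • f) g = r • K f g)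
    (K_skew : ∀ f g : R, K f g = - K g f)
    (K_leibniz : ∀ f g h : R, K f (g * h) = g • K f h + h • K f g)
    (PT1 : ∀ (f : R) (m n : M), D f (lb m n) = lb (D f m) n + lb m (D f n))
    (PT2 : ∀ (f g : R) (m : M), D f (D g m) - D g (D f m) - D (pb f g) m = lb (K f g) m)
    (PT3 : ∀ f g h : R,
      (D f (K g h) + K f (pb g h)) + (D g (K h f) + K g (pb h f))
        + (D h (K f g) + K h (pb f g)) = 0)
    (f : R) : MemM pb lb D K (D f) (pb f) := by
  have pb_neg (x y : R) : pb x (-y) = -pb x y := by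
    rw [pb_skew x, pb_skew x y, ← neg_one_smul ℝ y, pb_smul, neg_one_smul]
  have K_neg (x y : R) : K x (-y) = -K x y := by
    rw [K_skew x, K_skew x y, ← neg_one_smul ℝ y, K_smul, neg_one_smul]
  have D_neg (x : R) (m : M) : D x (-m) = -D x m := by
    rw [← neg_one_smul ℝ m, D_smul_right, neg_one_smul]
  have lb_neg (m n : M) : lb (-m) n = -lb m n := by
    rw [← neg_one_smul R m, lb_smul, neg_one_smul]
  refine ⟨⟨D_add_right f, D_smul_right f, ⟨fun g h => ?_, fun r g => ?_, pb_leibniz f⟩,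
    D_leibniz f⟩, PT1 f, fun g h => ?_, fun g => K g f,
    ⟨fun g h => K_add g h f, fun r g => K_smul r g f, fun g h => ?_⟩, fun g m => ?_,
    fun g h => ?_⟩
  all_goals beta_reduce
  · rw [pb_skew, pb_add, pb_skew f g, pb_skew f h]
    abel
  · rw [pb_skew, pb_smul, pb_skew f g, smul_neg]
  · have h1 := pb_jacobi f g h
    rw [pb_skew h f, pb_neg, pb_skew h (pb f g)] at h1
    linear_combination h1
  · rw [K_skew, K_leibniz, K_skew f g, K_skew f h]
    module
  · have D_symbol : D (pb f g) m = D f (D g m) - D g (D f m) - lb (K f g) m := by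
      rw [← PT2]
      abel
    rw [D_symbol, K_skew g f, lb_neg]
    abel
  · have h1 := PT3 f g h
    rw [pb_skew h f, K_neg, K_skew h (pb f g), K_skew f (pb g h), K_skew f g, D_neg] at h1
    rw [← sub_eq_zero, ← h1, K_skew g (pb f h)]
    abel

/-- `𝔐` is closed under differences, and symbols subtract. -/
theorem MemM.sub
    {pb : R → R → R}
    (pb_add : ∀ f g h : R, pb (f + g) h = pb f h + pb g h)
    (pb_skew : ∀ f g : R, pb f g = - pb g f)
    {lb : M → M → M}
    (lb_add : ∀ m n p : M, lb (m + n) p = lb m p + lb n p)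
    (lb_skew : ∀ m n : M, lb m n = - lb n m)
    {D : R → M → M}
    (D_add_left : ∀ (f g : R) (m : M), D (f + g) m = D f m + D g m)
    (D_add_right : ∀ (f : R) (m n : M), D f (m + n) = D f m + D f n)
    {K : R → R → M}
    (K_add : ∀ f g h : R, K (f + g) h = K f h + K g h)
    (K_skew : ∀ f g : R, K f g = - K g f)
    {δ ε : M → M} {u v : R → R} (hδ : MemM pb lb D K δ u) (hε : MemM pb lb D K ε v) :
    MemM pb lb D K (fun m => δ m - ε m) (fun f => u f - v f) := by
  have pb_sub_left (x y z : R) : pb (x - y) z = pb x z - pb y z :=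
    (AddMonoidHom.mk' (pb · z) fun x y => pb_add x y z).map_sub x y
  have pb_sub_right (x y z : R) : pb x (y - z) = pb x y - pb x z := by
    rw [pb_skew, pb_sub_left, pb_skew x y, pb_skew x z]
    abel
  have lb_sub_left (x y z : M) : lb (x - y) z = lb x z - lb y z :=
    (AddMonoidHom.mk' (lb · z) fun x y => lb_add x y z).map_sub x y
  have lb_sub_right (x y z : M) : lb x (y - z) = lb x y - lb x z := by
    rw [lb_skew, lb_sub_left, lb_skew x y, lb_skew x z]
    abel
  have K_sub_left (x y z : R) : K (x - y) z = K x z - K y z :=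
    (AddMonoidHom.mk' (K · z) fun x y => K_add x y z).map_sub x y
  have K_sub_right (x y z : R) : K x (y - z) = K x y - K x z := by
    rw [K_skew, K_sub_left, K_skew x y, K_skew x z]
    abel
  have D_sub_left (x y : R) (m : M) : D (x - y) m = D x m - D y m :=
    (AddMonoidHom.mk' (D · m) fun x y => D_add_left x y m).map_sub x y
  have D_sub_right (x : R) (m n : M) : D x (m - n) = D x m - D x n :=
    (AddMonoidHom.mk' (D x) (D_add_right x)).map_sub m n
  obtain ⟨⟨δ_add, δ_smul, ⟨u_add, u_smul, u_mul⟩, δ_leibniz⟩, δ_lb, u_pb,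
    P, ⟨P_add, P_smul, P_mul⟩, δA, δB⟩ := hδ
  obtain ⟨⟨ε_add, ε_smul, ⟨v_add, v_smul, v_mul⟩, ε_leibniz⟩, ε_lb, v_pb,
    Q, ⟨Q_add, Q_smul, Q_mul⟩, εA, εB⟩ := hε
  refine ⟨⟨fun m n => ?_, fun r m => ?_, ⟨fun f g => ?_, fun r f => ?_, fun f g => ?_⟩,
    fun f m => ?_⟩, fun m n => ?_, fun f g => ?_, fun f => P f - Q f,
    ⟨fun f g => ?_, fun r f => ?_, fun f g => ?_⟩, fun f m => ?_, fun f g => ?_⟩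
  all_goals beta_reduce
  · rw [δ_add, ε_add]
    abel
  · rw [δ_smul, ε_smul, smul_sub]
  · rw [u_add, v_add]
    abel
  · rw [u_smul, v_smul, smul_sub]
  · rw [u_mul, v_mul]
    ring
  · rw [δ_leibniz, ε_leibniz]
    module
  · rw [δ_lb, ε_lb, lb_sub_left, lb_sub_right]
    abel
  · rw [u_pb, v_pb, pb_sub_left, pb_sub_right]
    abel
  · rw [P_add, Q_add]
    abel
  · rw [P_smul, Q_smul, smul_sub]
  · rw [P_mul, Q_mul]
    module
  · rw [lb_sub_left, ← δA, ← εA, D_sub_left, D_sub_right]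
    abel
  · simp only [K_sub_left, K_sub_right, D_sub_right]
    have split : ∀ a b c a' b' c' : M,
        a - a' - (b - b') - (c - c') = (a - b - c) - (a' - b' - c') := by
      intros
      abel
    rw [split, δB, εB]
    abel

/-- The short exact sequence `0 → 𝔐₀/(𝒞₀ + Inn) → 𝔐/(𝒞 + Inn) → σ(𝔐)/Ham(R) → 0`,
formulated at the level of representatives: the inclusion-induced map is injective, the
symbol-induced map is well defined and surjective, and exactness holds in the middle. -/
theorem stmt_3
    (pb : R → R → R)
    (pb_add : ∀ f g h : R, pb (f + g) h = pb f h + pb g h)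
    (pb_smul : ∀ (r : ℝ) (f g : R), pb (r • f) g = r • pb f g)
    (pb_skew : ∀ f g : R, pb f g = - pb g f)
    (pb_jacobi : ∀ f g h : R, pb f (pb g h) + pb g (pb h f) + pb h (pb f g) = 0)
    (pb_leibniz : ∀ f g h : R, pb f (g * h) = pb f g * h + g * pb f h)
    (lb : M → M → M)
    (lb_add : ∀ m n p : M, lb (m + n) p = lb m p + lb n p)
    (lb_smul : ∀ (f : R) (m n : M), lb (f • m) n = f • lb m n)
    (lb_smul' : ∀ (f : R) (m n : M), lb m (f • n) = f • lb m n)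
    (lb_skew : ∀ m n : M, lb m n = - lb n m)
    (lb_jacobi : ∀ m n p : M, lb m (lb n p) + lb n (lb p m) + lb p (lb m n) = 0)
    (D : R → M → M)
    (D_add_left : ∀ (f g : R) (m : M), D (f + g) m = D f m + D g m)
    (D_smul_left : ∀ (r : ℝ) (f : R) (m : M), D (r • f) m = r • D f m)
    (D_add_right : ∀ (f : R) (m n : M), D f (m + n) = D f m + D f n)
    (D_smul_right : ∀ (f : R) (r : ℝ) (m : M), D f (r • m) = r • D f m)
    (D_mul : ∀ (f g : R) (m : M), D (f * g) m = f • D g m + g • D f m)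
    (D_leibniz : ∀ (f g : R) (m : M), D f (g • m) = g • D f m + pb f g • m)
    (K : R → R → M)
    (K_add : ∀ f g h : R, K (f + g) h = K f h + K g h)
    (K_smul : ∀ (r : ℝ) (f g : R), K (r • f) g = r • K f g)
    (K_skew : ∀ f g : R, K f g = - K g f)
    (K_leibniz : ∀ f g h : R, K f (g * h) = g • K f h + h • K f g)
    (PT1 : ∀ (f : R) (m n : M), D f (lb m n) = lb (D f m) n + lb m (D f n))
    (PT2 : ∀ (f g : R) (m : M), D f (D g m) - D g (D f m) - D (pb f g) m = lb (K f g) m)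
    (PT3 : ∀ f g h : R,
      (D f (K g h) + K f (pb g h)) + (D g (K h f) + K g (pb h f))
        + (D h (K f g) + K h (pb f g)) = 0)
    (faithful : ∀ f : R, (∀ m : M, f • m = 0) → f = 0)
    :
    -- injectivity of the first map: if δ ∈ 𝔐₀ lies in 𝒞 + Inn then δ ∈ 𝒞₀ + Inn
    (∀ δ : M → M, MemM pb lb D K δ (fun _ => (0 : R)) → MemCInn lb D δ →
      ∃ (δc : M → M) (η : M), MemC D δc ∧ MemM pb lb D K δc (fun _ => (0 : R)) ∧
        ∀ m : M, δ m = δc m + lb η m) ∧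
    -- the second map is well defined: symbols of elements of 𝒞 + Inn are Hamiltonian
    (∀ (δ : M → M) (u : R → R) (f : R) (η : M), MemM pb lb D K δ u →
      (∀ m : M, δ m = D f m + lb η m) → ∃ h : R, ∀ g : R, u g = pb h g) ∧
    -- image of the first map ⊆ kernel of the second: symbols of 𝔐₀ are Hamiltonian
    (∀ δ : M → M, MemM pb lb D K δ (fun _ => (0 : R)) →
      ∃ h : R, ∀ g : R, (0 : R) = pb h g) ∧
    -- kernel of the second map ⊆ image of the first
    (∀ (δ : M → M) (u : R → R), MemM pb lb D K δ u →
      (∃ h : R, ∀ g : R, u g = pb h g) →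
      ∃ δ0 : M → M, MemM pb lb D K δ0 (fun _ => (0 : R)) ∧
        MemCInn lb D (fun m => δ m - δ0 m)) ∧
    -- the second map is surjective onto σ(𝔐)/Ham(R)
    (∀ u : R → R, (∃ δ : M → M, MemM pb lb D K δ u) →
      ∃ δ : M → M, MemM pb lb D K δ u) := by
  have D_mem (f : R) : MemM pb lb D K (D f) (pb f) :=
    memM_D pb_add pb_smul pb_skew pb_jacobi pb_leibniz lb_smul D_add_right D_smul_right D_leibniz
      K_add K_smul K_skew K_leibniz PT1 PT2 PT3 f
  have lb_zero (m : M) : lb 0 m = 0 := by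
    simpa using lb_smul 0 0 m
  have symbol_eq {δ : M → M} {u : R → R} {f : R} {η : M} (hδ : MemM pb lb D K δ u)
      (h : ∀ m, δ m = D f m + lb η m) (g : R) : u g = pb f g := by
    refine sub_eq_zero.mp (faithful _ fun m => ?_)
    have hm := hδ.1.2.2.2 g m
    rw [h, h, D_leibniz, lb_smul'] at hm
    rw [sub_smul, sub_eq_zero, ← add_right_inj (g • (D f m + lb η m)), ← hm]
    module
  refine ⟨?_, ?_, ?_, ?_, fun u h => h⟩
  · rintro δ hδ ⟨f, η, h⟩
    have hf : pb f = fun _ => 0 := funext fun g => (symbol_eq hδ h g).symm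
    exact ⟨D f, η, ⟨f, fun _ => rfl⟩, hf ▸ D_mem f, h⟩
  · exact fun δ u f η hδ h => ⟨f, symbol_eq hδ h⟩
  · exact fun δ _ => ⟨0, fun g => by rw [← zero_smul ℝ (0 : R), pb_smul, zero_smul, zero_smul]⟩
  · rintro δ u hδ ⟨h, hu⟩
    refine ⟨fun m => δ m - D h m, ?_, h, 0, fun m => by simp [lb_zero]⟩
    have key := hδ.sub pb_add pb_skew lb_add lb_skew D_add_left D_add_right K_add K_skew (D_mem h)
    simpa only [hu, sub_self] using key
end

section
/- Every derivation X of A decomposes uniquely as X = X_δ + X_Q: there exist a unique derivative endomorphism δ of M (with a unique symbol u) and a unique derivation Q: R→M such that X((f,η)) = (u(f), δ(η) + Q(f)) for all (f,η) ∈ A. -/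
variable {R : Type*} [CommRing R] [Algebra ℝ R]
variable {M : Type*} [AddCommGroup M] [Module R M] [Module ℝ M] [IsScalarTower ℝ R M]

/-- The `R`-component of a derivation of `R ⊕ M` vanishes on `M` under the hypothesis `MH`. -/
theorem IsADeriv.fst_apply_inr {X : R × M → R × M} (hX : IsADeriv X)
    (MH : ∀ φ : M → R, (∀ m n : M, φ (m + n) = φ m + φ n) →
      (∀ (f : R) (m : M), φ (f • m) = f * φ m) → (∀ m : M, φ m • m = 0) →
      ∀ m : M, φ m = 0) (m : M) : (X (0, m)).1 = 0 := by
  obtain ⟨hadd, hsmul, hmul⟩ := hX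
  have hzero : X 0 = 0 := by simpa using hadd 0 0
  refine MH (fun m => (X (0, m)).1) (fun m n => ?_) (fun f m => ?_) (fun m => ?_) m
  · simpa using congrArg Prod.fst (hadd (0, m) (0, n))
  · simpa [amul] using congrArg Prod.fst (hmul (f, 0) (0, m))
  · have h := congrArg Prod.snd (hmul (0, m) (0, m))
    have h2 : (X (0, m)).1 • m + (X (0, m)).1 • m = 0 := by
      simpa [amul, hzero, ← Prod.zero_eq_mk, eq_comm] using h
    have h3 : (2 : ℝ) • ((X (0, m)).1 • m) = 0 := by rw [two_smul, h2]
    exact (smul_eq_zero.mp h3).resolve_left two_ne_zero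

/-- Every derivation `X` of `A = R ⊕ M` decomposes uniquely as `X = X_δ + X_Q` for a
derivative endomorphism `δ` of `M` (with unique symbol `u`) and a derivation `Q : R → M`. -/
theorem stmt_4
    (MH : ∀ φ : M → R, (∀ m n : M, φ (m + n) = φ m + φ n) →
      (∀ (f : R) (m : M), φ (f • m) = f * φ m) → (∀ m : M, φ m • m = 0) →
      ∀ m : M, φ m = 0)
    (faithful : ∀ f : R, (∀ m : M, f • m = 0) → f = 0)
    :
    ∀ X : R × M → R × M, IsADeriv X →
      ∃ (δ : M → M) (u : R → R) (Q : R → M),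
        IsDerivEndo δ u ∧ IsDerivRM Q ∧
        (∀ a : R × M, X a = (u a.1, δ a.2 + Q a.1)) ∧
        ∀ (δ' : M → M) (u' : R → R) (Q' : R → M),
          IsDerivEndo δ' u' → IsDerivRM Q' →
          (∀ a : R × M, X a = (u' a.1, δ' a.2 + Q' a.1)) →
          δ' = δ ∧ u' = u ∧ Q' = Q := by
  intro X hX
  have hfst := hX.fst_apply_inr MH
  obtain ⟨hadd, hsmul, hmul⟩ := hX
  have hsplit : ∀ a : R × M, X a = X (a.1, 0) + X (0, a.2) := fun a => by
    rw [← hadd]; simp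
  refine ⟨fun m => (X (0, m)).2, fun f => (X (f, 0)).1, fun f => (X (f, 0)).2,
    ⟨fun m n => ?_, fun r m => ?_, ⟨fun f g => ?_, fun r f => ?_, fun f g => ?_⟩, fun f m => ?_⟩,
    ⟨fun f g => ?_, fun r f => ?_, fun f g => ?_⟩, fun a => ?_, ?_⟩
  · simpa using congrArg Prod.snd (hadd (0, m) (0, n))
  · simpa using congrArg Prod.snd (hsmul r (0, m))
  · simpa using congrArg Prod.fst (hadd (f, 0) (g, 0))
  · simpa using congrArg Prod.fst (hsmul r (f, 0))
  · simpa [amul] using congrArg Prod.fst (hmul (f, 0) (g, 0))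
  · simpa [amul, add_comm] using congrArg Prod.snd (hmul (f, 0) (0, m))
  · simpa using congrArg Prod.snd (hadd (f, 0) (g, 0))
  · simpa using congrArg Prod.snd (hsmul r (f, 0))
  · simpa [amul, add_comm] using congrArg Prod.snd (hmul (f, 0) (g, 0))
  · rw [hsplit a]
    ext <;> simp [hfst, add_comm]
  · intro δ' u' Q' hδ hQ h
    have hδ0 : δ' 0 = 0 := by simpa using hδ.1 0 0
    have hQ0 : Q' 0 = 0 := by simpa using hQ.1 0 0
    refine ⟨?_, ?_, ?_⟩ <;> funext x <;> simp [h, hδ0, hQ0]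
end

section
/- For every derivation X of A and every m ∈ M, the R-component of X((0,m)) vanishes; equivalently, X maps the submodule 0 ⊕ M of A into itself. -/
variable {R : Type*} [CommRing R] [Algebra ℝ R]
variable {M : Type*} [AddCommGroup M] [Module R M] [Module ℝ M] [IsScalarTower ℝ R M]

/-- For every derivation `X` of `A = R ⊕ M`, the `R`-component of `X (0, m)` vanishes;
i.e. `X` maps the submodule `0 ⊕ M` into itself. -/
theorem stmt_5
    (MH : ∀ φ : M → R, (∀ m n : M, φ (m + n) = φ m + φ n) →
      (∀ (f : R) (m : M), φ (f • m) = f * φ m) → (∀ m : M, φ m • m = 0) →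
      ∀ m : M, φ m = 0)
    :
    ∀ X : R × M → R × M, IsADeriv X → ∀ m : M, (X ((0 : R), m)).1 = 0 := by
  rintro X ⟨hadd, -, hmul⟩
  have hzero : X 0 = 0 := by simpa using hadd 0 0
  refine MH (fun m => (X (0, m)).1) (fun m n => ?_) (fun f m => ?_) (fun m => ?_)
  · simpa using congrArg Prod.fst (hadd (0, m) (0, n))
  · simpa [amul] using congrArg Prod.fst (hmul (f, 0) (0, m))
  · have hsq : amul ((0 : R), m) (0, m) = 0 := by simp [amul]
    have hdouble : (X (0, m)).1 • m + (X (0, m)).1 • m = 0 := by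
      have h := congrArg Prod.snd (hmul (0, m) (0, m))
      rw [hsq, hzero] at h
      simpa [amul] using h.symm
    rw [← two_smul ℝ] at hdouble
    exact (smul_eq_zero.mp hdouble).resolve_left two_ne_zero
end

section
/- The affine bracket {·,·}ᵃ makes A a Poisson algebra: it is ℝ-bilinear and antisymmetric, satisfies the Leibniz rule {a, b·c}ᵃ = {a,b}ᵃ·c + b·{a,c}ᵃ for all a,b,c ∈ A, and satisfies the Jacobi identity. -/
variable {R : Type*} [CommRing R] [Algebra ℝ R]
variable {M : Type*} [AddCommGroup M] [Module R M] [Module ℝ M] [IsScalarTower ℝ R M]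

/-- The affine bracket makes `A = R ⊕ M` a Poisson algebra: it is ℝ-bilinear,
antisymmetric, satisfies the Leibniz rule, and satisfies the Jacobi identity. -/
theorem stmt_7
    (pb : R → R → R)
    (pb_add : ∀ f g h : R, pb (f + g) h = pb f h + pb g h)
    (pb_smul : ∀ (r : ℝ) (f g : R), pb (r • f) g = r • pb f g)
    (pb_skew : ∀ f g : R, pb f g = - pb g f)
    (pb_jacobi : ∀ f g h : R, pb f (pb g h) + pb g (pb h f) + pb h (pb f g) = 0)
    (pb_leibniz : ∀ f g h : R, pb f (g * h) = pb f g * h + g * pb f h)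
    (lb : M → M → M)
    (lb_add : ∀ m n p : M, lb (m + n) p = lb m p + lb n p)
    (lb_smul : ∀ (f : R) (m n : M), lb (f • m) n = f • lb m n)
    (lb_smul' : ∀ (f : R) (m n : M), lb m (f • n) = f • lb m n)
    (lb_skew : ∀ m n : M, lb m n = - lb n m)
    (lb_jacobi : ∀ m n p : M, lb m (lb n p) + lb n (lb p m) + lb p (lb m n) = 0)
    (D : R → M → M)
    (D_add_left : ∀ (f g : R) (m : M), D (f + g) m = D f m + D g m)
    (D_smul_left : ∀ (r : ℝ) (f : R) (m : M), D (r • f) m = r • D f m)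
    (D_add_right : ∀ (f : R) (m n : M), D f (m + n) = D f m + D f n)
    (D_smul_right : ∀ (f : R) (r : ℝ) (m : M), D f (r • m) = r • D f m)
    (D_mul : ∀ (f g : R) (m : M), D (f * g) m = f • D g m + g • D f m)
    (D_leibniz : ∀ (f g : R) (m : M), D f (g • m) = g • D f m + pb f g • m)
    (K : R → R → M)
    (K_add : ∀ f g h : R, K (f + g) h = K f h + K g h)
    (K_smul : ∀ (r : ℝ) (f g : R), K (r • f) g = r • K f g)
    (K_skew : ∀ f g : R, K f g = - K g f)
    (K_leibniz : ∀ f g h : R, K f (g * h) = g • K f h + h • K f g)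
    (PT1 : ∀ (f : R) (m n : M), D f (lb m n) = lb (D f m) n + lb m (D f n))
    (PT2 : ∀ (f g : R) (m : M), D f (D g m) - D g (D f m) - D (pb f g) m = lb (K f g) m)
    (PT3 : ∀ f g h : R,
      (D f (K g h) + K f (pb g h)) + (D g (K h f) + K g (pb h f))
        + (D h (K f g) + K h (pb f g)) = 0)
    :
    (∀ a b c : R × M, abr pb lb D K (a + b) c = abr pb lb D K a c + abr pb lb D K b c) ∧
    (∀ (r : ℝ) (a b : R × M), abr pb lb D K (r • a) b = r • abr pb lb D K a b) ∧
    (∀ a b c : R × M, abr pb lb D K a (b + c) = abr pb lb D K a b + abr pb lb D K a c) ∧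
    (∀ (r : ℝ) (a b : R × M), abr pb lb D K a (r • b) = r • abr pb lb D K a b) ∧
    (∀ a b : R × M, abr pb lb D K a b = - abr pb lb D K b a) ∧
    (∀ a b c : R × M, abr pb lb D K a (amul b c) =
      amul (abr pb lb D K a b) c + amul b (abr pb lb D K a c)) ∧
    (∀ a b c : R × M, abr pb lb D K a (abr pb lb D K b c) +
      abr pb lb D K b (abr pb lb D K c a) + abr pb lb D K c (abr pb lb D K a b) = 0) := by
  have D_neg (f : R) (m : M) : D f (-m) = - D f m := by
    simpa using D_smul_right f (-1) m
  have lb_neg (m n : M) : lb (-m) n = - lb m n := by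
    simpa using lb_smul (-1) m n
  have lb_real (r : ℝ) (m n : M) : lb (r • m) n = r • lb m n := by
    rw [← algebraMap_smul R r m, lb_smul, algebraMap_smul]
  have add_left (a b c : R × M) :
      abr pb lb D K (a + b) c = abr pb lb D K a c + abr pb lb D K b c := by
    ext
    · simp only [abr, Prod.fst_add, pb_add]
    · simp only [abr, Prod.fst_add, Prod.snd_add, D_add_left, D_add_right, lb_add, K_add]
      abel
  have smul_left (r : ℝ) (a b : R × M) :
      abr pb lb D K (r • a) b = r • abr pb lb D K a b := by
    ext
    · simp only [abr, Prod.smul_fst, pb_smul]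
    · simp only [abr, Prod.smul_fst, Prod.smul_snd, D_smul_left, D_smul_right, lb_real, K_smul,
        smul_add, smul_sub]
  have skew (a b : R × M) : abr pb lb D K a b = - abr pb lb D K b a := by
    ext
    · exact pb_skew _ _
    · simp only [abr, Prod.snd_neg]
      rw [lb_skew a.2, K_skew a.1]
      abel
  refine ⟨add_left, smul_left, fun a b c => ?_, fun r a b => ?_, skew, fun a b c => ?_,
    fun a b c => ?_⟩
  · rw [skew a, add_left, skew b, skew c]
    abel
  · rw [skew a, smul_left, skew b, smul_neg, neg_neg]
  · have lb_add_right (m n p : M) : lb m (n + p) = lb m n + lb m p := by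
      rw [lb_skew, lb_add, lb_skew n, lb_skew p]
      abel
    ext
    · simp only [abr, amul, Prod.fst_add, pb_leibniz]
    · simp only [abr, amul, Prod.snd_add, D_add_right, D_leibniz, D_mul, lb_add_right, lb_smul',
        K_leibniz, smul_add, smul_sub]
      abel
  · obtain ⟨f, m⟩ := a
    obtain ⟨g, n⟩ := b
    obtain ⟨h, p⟩ := c
    ext
    · exact pb_jacobi f g h
    · have PT2' (f g : R) (m : M) :
          D (pb f g) m = D f (D g m) - D g (D f m) - lb (K f g) m := by
        rw [← PT2]
        abel
      have jac := lb_jacobi m n p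
      have pt3 := PT3 f g h
      simp only [lb_skew m (lb n p), lb_skew n (lb p m), lb_skew p (lb m n)] at jac
      simp only [abr, Prod.snd_add, Prod.snd_zero, sub_eq_add_neg, D_add_right, D_neg, PT1, PT2']
      rw [lb_skew m, lb_skew n (_ + _), lb_skew p (_ + _)]
      simp only [lb_add, lb_neg]
      rw [lb_skew n (D f p), lb_skew p (D g m), lb_skew m (D h n)]
      linear_combination (norm := abel) jac + pt3
end

section
/- The center-valued contravariant differential squares to zero in low degrees: (a) for every ζ ∈ Z and all f,g ∈ R, D_f(D_g ζ) − D_g(D_f ζ) − D_{{f,g}}ζ = 0; (b) for every derivation Q: R→M taking values in Z, setting P(f,g) = D_f(Q(g)) − D_g(Q(f)) − Q({f,g}), one has D_f(P(g,h)) − D_g(P(f,h)) + D_h(P(f,g)) − P({f,g},h) + P({f,h},g) − P({g,h},f) = 0 for all f,g,h ∈ R. -/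
variable {R : Type*} [CommRing R] [Algebra ℝ R]
variable {M : Type*} [AddCommGroup M] [Module R M] [Module ℝ M] [IsScalarTower ℝ R M]

/-- The center-valued contravariant differential squares to zero in low degrees. -/
theorem stmt_9
    (pb : R → R → R)
    (pb_add : ∀ f g h : R, pb (f + g) h = pb f h + pb g h)
    (pb_smul : ∀ (r : ℝ) (f g : R), pb (r • f) g = r • pb f g)
    (pb_skew : ∀ f g : R, pb f g = - pb g f)
    (pb_jacobi : ∀ f g h : R, pb f (pb g h) + pb g (pb h f) + pb h (pb f g) = 0)
    (pb_leibniz : ∀ f g h : R, pb f (g * h) = pb f g * h + g * pb f h)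
    (lb : M → M → M)
    (lb_add : ∀ m n p : M, lb (m + n) p = lb m p + lb n p)
    (lb_smul : ∀ (f : R) (m n : M), lb (f • m) n = f • lb m n)
    (lb_smul' : ∀ (f : R) (m n : M), lb m (f • n) = f • lb m n)
    (lb_skew : ∀ m n : M, lb m n = - lb n m)
    (lb_jacobi : ∀ m n p : M, lb m (lb n p) + lb n (lb p m) + lb p (lb m n) = 0)
    (D : R → M → M)
    (D_add_left : ∀ (f g : R) (m : M), D (f + g) m = D f m + D g m)
    (D_smul_left : ∀ (r : ℝ) (f : R) (m : M), D (r • f) m = r • D f m)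
    (D_add_right : ∀ (f : R) (m n : M), D f (m + n) = D f m + D f n)
    (D_smul_right : ∀ (f : R) (r : ℝ) (m : M), D f (r • m) = r • D f m)
    (D_mul : ∀ (f g : R) (m : M), D (f * g) m = f • D g m + g • D f m)
    (D_leibniz : ∀ (f g : R) (m : M), D f (g • m) = g • D f m + pb f g • m)
    (K : R → R → M)
    (K_add : ∀ f g h : R, K (f + g) h = K f h + K g h)
    (K_smul : ∀ (r : ℝ) (f g : R), K (r • f) g = r • K f g)
    (K_skew : ∀ f g : R, K f g = - K g f)
    (K_leibniz : ∀ f g h : R, K f (g * h) = g • K f h + h • K f g)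
    (PT1 : ∀ (f : R) (m n : M), D f (lb m n) = lb (D f m) n + lb m (D f n))
    (PT2 : ∀ (f g : R) (m : M), D f (D g m) - D g (D f m) - D (pb f g) m = lb (K f g) m)
    :
    (∀ ζ : M, (∀ m : M, lb ζ m = 0) →
      ∀ f g : R, D f (D g ζ) - D g (D f ζ) - D (pb f g) ζ = 0) ∧
    (∀ Q : R → M, IsDerivRM Q → (∀ (f : R) (m : M), lb (Q f) m = 0) →
      ∀ P : R → R → M, (∀ f g : R, P f g = D f (Q g) - D g (Q f) - Q (pb f g)) →
        ∀ f g h : R,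
          D f (P g h) - D g (P f h) + D h (P f g)
            - P (pb f g) h + P (pb f h) g - P (pb g h) f = 0) := by
  have flat : ∀ ζ : M, (∀ m : M, lb ζ m = 0) →
      ∀ f g : R, D f (D g ζ) - D g (D f ζ) - D (pb f g) ζ = 0 := by
    intro ζ hζ f g
    rw [PT2, lb_skew, hζ, neg_zero]
  refine ⟨flat, ?_⟩
  rintro Q ⟨Q_add, -, -⟩ hQ P hP f g h
  have D_sub (f : R) (m n : M) : D f (m - n) = D f m - D f n :=
    map_sub (AddMonoidHom.mk' (D f) (D_add_right f)) m n
  have pb_neg (f g : R) : pb (-f) g = -pb f g :=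
    map_neg (AddMonoidHom.mk' (fun f => pb f g) (fun a b => pb_add a b g)) f
  have jacobi : pb (pb f h) g = pb (pb f g) h + pb (pb g h) f := by
    have hJ := pb_jacobi f g h
    rw [pb_skew f (pb g h), pb_skew g (pb h f), pb_skew h (pb f g), pb_skew h f,
      pb_neg] at hJ
    linear_combination hJ
  have Q_jacobi : Q (pb (pb f h) g) = Q (pb (pb f g) h) + Q (pb (pb g h) f) := by
    rw [jacobi, Q_add]
  have flat_fg := flat (Q h) (hQ h) f g
  have flat_fh := flat (Q g) (hQ g) f h
  have flat_gh := flat (Q f) (hQ f) g h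
  simp only [hP, D_sub, Q_jacobi]
  linear_combination (norm := abel) flat_fg - flat_fh + flat_gh
end

section
/- For every f ∈ R, the operator D_f belongs to 𝔐: D_f is a derivative endomorphism of M with symbol {f,·}, it is a derivation of [·,·]₁, the symbol {f,·} is a Poisson derivation of R, and conditions (A) and (B) in the definition of 𝔐 hold with witness Q̃(g) = −K(f,g). In particular 𝒞 ⊆ 𝔐. -/
variable {R : Type*} [CommRing R] [Algebra ℝ R]
variable {M : Type*} [AddCommGroup M] [Module R M] [Module ℝ M] [IsScalarTower ℝ R M]

/-- For every `f ∈ R` the operator `D_f` belongs to `𝔐`, with symbol `{f,·}` and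
witness `Q̃ g = -K f g`; in particular `𝒞 ⊆ 𝔐`. -/
theorem stmt_11
    (pb : R → R → R)
    (pb_add : ∀ f g h : R, pb (f + g) h = pb f h + pb g h)
    (pb_smul : ∀ (r : ℝ) (f g : R), pb (r • f) g = r • pb f g)
    (pb_skew : ∀ f g : R, pb f g = - pb g f)
    (pb_jacobi : ∀ f g h : R, pb f (pb g h) + pb g (pb h f) + pb h (pb f g) = 0)
    (pb_leibniz : ∀ f g h : R, pb f (g * h) = pb f g * h + g * pb f h)
    (lb : M → M → M)
    (lb_add : ∀ m n p : M, lb (m + n) p = lb m p + lb n p)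
    (lb_smul : ∀ (f : R) (m n : M), lb (f • m) n = f • lb m n)
    (lb_smul' : ∀ (f : R) (m n : M), lb m (f • n) = f • lb m n)
    (lb_skew : ∀ m n : M, lb m n = - lb n m)
    (lb_jacobi : ∀ m n p : M, lb m (lb n p) + lb n (lb p m) + lb p (lb m n) = 0)
    (D : R → M → M)
    (D_add_left : ∀ (f g : R) (m : M), D (f + g) m = D f m + D g m)
    (D_smul_left : ∀ (r : ℝ) (f : R) (m : M), D (r • f) m = r • D f m)
    (D_add_right : ∀ (f : R) (m n : M), D f (m + n) = D f m + D f n)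
    (D_smul_right : ∀ (f : R) (r : ℝ) (m : M), D f (r • m) = r • D f m)
    (D_mul : ∀ (f g : R) (m : M), D (f * g) m = f • D g m + g • D f m)
    (D_leibniz : ∀ (f g : R) (m : M), D f (g • m) = g • D f m + pb f g • m)
    (K : R → R → M)
    (K_add : ∀ f g h : R, K (f + g) h = K f h + K g h)
    (K_smul : ∀ (r : ℝ) (f g : R), K (r • f) g = r • K f g)
    (K_skew : ∀ f g : R, K f g = - K g f)
    (K_leibniz : ∀ f g h : R, K f (g * h) = g • K f h + h • K f g)
    (PT1 : ∀ (f : R) (m n : M), D f (lb m n) = lb (D f m) n + lb m (D f n))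
    (PT2 : ∀ (f g : R) (m : M), D f (D g m) - D g (D f m) - D (pb f g) m = lb (K f g) m)
    (PT3 : ∀ f g h : R,
      (D f (K g h) + K f (pb g h)) + (D g (K h f) + K g (pb h f))
        + (D h (K f g) + K h (pb f g)) = 0)
    :
    (∀ f : R,
      IsDerivEndo (fun m => D f m) (fun g => pb f g) ∧
      (∀ m n : M, D f (lb m n) = lb (D f m) n + lb m (D f n)) ∧
      (∀ g h : R, pb f (pb g h) = pb (pb f g) h + pb g (pb f h)) ∧
      IsDerivRM (fun g => -(K f g)) ∧
      (∀ (g : R) (m : M), D g (D f m) - D f (D g m) + D (pb f g) m = lb (-(K f g)) m) ∧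
      (∀ g h : R, D f (K g h) - K (pb f g) h - K g (pb f h) =
        -(D g (-(K f h)) - D h (-(K f g)) - (-(K f (pb g h))))) ∧
      MemM pb lb D K (fun m => D f m) (fun g => pb f g)) ∧
    (∀ δ : M → M, MemC D δ → ∃ u : R → R, MemM pb lb D K δ u) := by
  have pb_add_right (f g h : R) : pb f (g + h) = pb f g + pb f h := by
    rw [pb_skew, pb_add, pb_skew g, pb_skew h]; abel
  have pb_smul_right (r : ℝ) (f g : R) : pb f (r • g) = r • pb f g := by
    rw [pb_skew, pb_smul, pb_skew g, smul_neg, neg_neg]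
  have pb_neg_right (f g : R) : pb f (-g) = -pb f g := by
    simpa using pb_smul_right (-1) f g
  have K_add_right (f g h : R) : K f (g + h) = K f g + K f h := by
    rw [K_skew, K_add, K_skew g, K_skew h]; abel
  have K_smul_right (r : ℝ) (f g : R) : K f (r • g) = r • K f g := by
    rw [K_skew, K_smul, K_skew g, smul_neg, neg_neg]
  have K_neg_right (f g : R) : K f (-g) = -K f g := by
    simpa using K_smul_right (-1) f g
  have D_neg_right (f : R) (m : M) : D f (-m) = -D f m := by
    simpa using D_smul_right f (-1) m
  have lb_neg (m n : M) : lb (-m) n = -lb m n := by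
    simpa using lb_smul (-1) m n
  have endo (f : R) : IsDerivEndo (fun m => D f m) (fun g => pb f g) :=
    ⟨D_add_right f, D_smul_right f,
      ⟨pb_add_right f, fun r g => pb_smul_right r f g, pb_leibniz f⟩, D_leibniz f⟩
  have poisson (f g h : R) : pb f (pb g h) = pb (pb f g) h + pb g (pb f h) := by
    have J := pb_jacobi f g h
    rw [pb_skew h f, pb_neg_right, pb_skew h (pb f g)] at J
    linear_combination J
  have witness (f : R) : IsDerivRM (fun g => -(K f g)) := by
    refine ⟨fun g h => ?_, fun r g => ?_, fun g h => ?_⟩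
    · simp only [K_add_right, neg_add]
    · simp only [K_smul_right, smul_neg]
    · simp only [K_leibniz, neg_add, smul_neg]
  have condA (f g : R) (m : M) :
      D g (D f m) - D f (D g m) + D (pb f g) m = lb (-(K f g)) m := by
    rw [lb_neg, ← PT2]; abel
  have condB (f g h : R) : D f (K g h) - K (pb f g) h - K g (pb f h) =
      -(D g (-(K f h)) - D h (-(K f g)) - (-(K f (pb g h)))) := by
    have T := PT3 f g h
    rw [K_skew h f, pb_skew h f, K_skew h (pb f g), D_neg_right, K_neg_right] at T
    rw [D_neg_right, D_neg_right, ← sub_eq_zero, ← T]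
    abel
  have mem (f : R) : MemM pb lb D K (fun m => D f m) (fun g => pb f g) :=
    ⟨endo f, PT1 f, poisson f, _, witness f, condA f, condB f⟩
  refine ⟨fun f => ⟨endo f, PT1 f, poisson f, witness f, condA f, condB f, mem f⟩, ?_⟩
  rintro δ ⟨f, hf⟩
  obtain rfl : δ = fun m => D f m := funext hf
  exact ⟨_, mem f⟩
end

section
/- If Q is a ∂_D-cocycle, then X_Q (given by X_Q((f,η)) = (0, Q(f))) is a Poisson derivation of A. -/
variable {R : Type*} [CommRing R] [Algebra ℝ R]
variable {M : Type*} [AddCommGroup M] [Module R M] [Module ℝ M] [IsScalarTower ℝ R M]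

/-- If `Q` is a `∂_D`-cocycle, then `X_Q` is a Poisson derivation of `A`. -/
theorem stmt_16
    (pb : R → R → R)
    (pb_add : ∀ f g h : R, pb (f + g) h = pb f h + pb g h)
    (pb_smul : ∀ (r : ℝ) (f g : R), pb (r • f) g = r • pb f g)
    (pb_skew : ∀ f g : R, pb f g = - pb g f)
    (pb_jacobi : ∀ f g h : R, pb f (pb g h) + pb g (pb h f) + pb h (pb f g) = 0)
    (pb_leibniz : ∀ f g h : R, pb f (g * h) = pb f g * h + g * pb f h)
    (lb : M → M → M)
    (lb_add : ∀ m n p : M, lb (m + n) p = lb m p + lb n p)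
    (lb_smul : ∀ (f : R) (m n : M), lb (f • m) n = f • lb m n)
    (lb_smul' : ∀ (f : R) (m n : M), lb m (f • n) = f • lb m n)
    (lb_skew : ∀ m n : M, lb m n = - lb n m)
    (lb_jacobi : ∀ m n p : M, lb m (lb n p) + lb n (lb p m) + lb p (lb m n) = 0)
    (D : R → M → M)
    (D_add_left : ∀ (f g : R) (m : M), D (f + g) m = D f m + D g m)
    (D_smul_left : ∀ (r : ℝ) (f : R) (m : M), D (r • f) m = r • D f m)
    (D_add_right : ∀ (f : R) (m n : M), D f (m + n) = D f m + D f n)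
    (D_smul_right : ∀ (f : R) (r : ℝ) (m : M), D f (r • m) = r • D f m)
    (D_mul : ∀ (f g : R) (m : M), D (f * g) m = f • D g m + g • D f m)
    (D_leibniz : ∀ (f g : R) (m : M), D f (g • m) = g • D f m + pb f g • m)
    (K : R → R → M)
    (K_add : ∀ f g h : R, K (f + g) h = K f h + K g h)
    (K_smul : ∀ (r : ℝ) (f g : R), K (r • f) g = r • K f g)
    (K_skew : ∀ f g : R, K f g = - K g f)
    (K_leibniz : ∀ f g h : R, K f (g * h) = g • K f h + h • K f g)
    (PT1 : ∀ (f : R) (m n : M), D f (lb m n) = lb (D f m) n + lb m (D f n))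
    (PT2 : ∀ (f g : R) (m : M), D f (D g m) - D g (D f m) - D (pb f g) m = lb (K f g) m)
    (PT3 : ∀ f g h : R,
      (D f (K g h) + K f (pb g h)) + (D g (K h f) + K g (pb h f))
        + (D h (K f g) + K h (pb f g)) = 0)
    :
    ∀ Q : R → M, IsCocycle pb lb D Q →
      IsPoissonDeriv pb lb D K (fun a : R × M => ((0 : R), Q a.1)) := by
  rintro Q ⟨⟨Q_add, Q_smul, Q_mul⟩, Q_central, Q_cocycle⟩
  have pb_zero_left (g : R) : pb 0 g = 0 := by simpa using pb_add 0 0 g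
  have pb_zero_right (g : R) : pb g 0 = 0 := by rw [pb_skew, pb_zero_left, neg_zero]
  have D_zero_left (m : M) : D 0 m = 0 := by simpa using D_add_left 0 0 m
  have K_zero_left (g : R) : K 0 g = 0 := by simpa using K_add 0 0 g
  have K_zero_right (g : R) : K g 0 = 0 := by rw [K_skew, K_zero_left, neg_zero]
  have lb_Q_right (m : M) (f : R) : lb m (Q f) = 0 := by rw [lb_skew, Q_central, neg_zero]
  refine ⟨⟨fun a b => ?_, fun r a => ?_, fun a b => ?_⟩, fun a b => ?_⟩
  · simp [Q_add]
  · simp [Q_smul]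
  · simp [amul, Q_mul, add_comm]
  · simp [abr, pb_zero_left, pb_zero_right, D_zero_left, K_zero_left, K_zero_right,
      Q_central, lb_Q_right, ← Q_cocycle, sub_eq_neg_add]
end

section
/- If Q: R→M is a derivation such that X_Q (given by X_Q((f,η)) = (0, Q(f))) is a Poisson derivation of A, then Q is a ∂_D-cocycle: Q takes values in the center Z and D_f(Q(g)) − D_g(Q(f)) = Q({f,g}) for all f,g ∈ R. -/
variable {R : Type*} [CommRing R] [Algebra ℝ R]
variable {M : Type*} [AddCommGroup M] [Module R M] [Module ℝ M] [IsScalarTower ℝ R M]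

/-- If `Q : R → M` is a derivation such that `X_Q` is a Poisson derivation of `A`, then
`Q` is a `∂_D`-cocycle: it takes values in the center and satisfies the cocycle identity. -/
theorem stmt_18
    (pb : R → R → R)
    (pb_add : ∀ f g h : R, pb (f + g) h = pb f h + pb g h)
    (pb_smul : ∀ (r : ℝ) (f g : R), pb (r • f) g = r • pb f g)
    (pb_skew : ∀ f g : R, pb f g = - pb g f)
    (pb_jacobi : ∀ f g h : R, pb f (pb g h) + pb g (pb h f) + pb h (pb f g) = 0)
    (pb_leibniz : ∀ f g h : R, pb f (g * h) = pb f g * h + g * pb f h)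
    (lb : M → M → M)
    (lb_add : ∀ m n p : M, lb (m + n) p = lb m p + lb n p)
    (lb_smul : ∀ (f : R) (m n : M), lb (f • m) n = f • lb m n)
    (lb_smul' : ∀ (f : R) (m n : M), lb m (f • n) = f • lb m n)
    (lb_skew : ∀ m n : M, lb m n = - lb n m)
    (lb_jacobi : ∀ m n p : M, lb m (lb n p) + lb n (lb p m) + lb p (lb m n) = 0)
    (D : R → M → M)
    (D_add_left : ∀ (f g : R) (m : M), D (f + g) m = D f m + D g m)
    (D_smul_left : ∀ (r : ℝ) (f : R) (m : M), D (r • f) m = r • D f m)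
    (D_add_right : ∀ (f : R) (m n : M), D f (m + n) = D f m + D f n)
    (D_smul_right : ∀ (f : R) (r : ℝ) (m : M), D f (r • m) = r • D f m)
    (D_mul : ∀ (f g : R) (m : M), D (f * g) m = f • D g m + g • D f m)
    (D_leibniz : ∀ (f g : R) (m : M), D f (g • m) = g • D f m + pb f g • m)
    (K : R → R → M)
    (K_add : ∀ f g h : R, K (f + g) h = K f h + K g h)
    (K_smul : ∀ (r : ℝ) (f g : R), K (r • f) g = r • K f g)
    (K_skew : ∀ f g : R, K f g = - K g f)
    (K_leibniz : ∀ f g h : R, K f (g * h) = g • K f h + h • K f g)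
    :
    ∀ Q : R → M, IsDerivRM Q →
      IsPoissonDeriv pb lb D K (fun a : R × M => ((0 : R), Q a.1)) →
      (∀ (f : R) (m : M), lb (Q f) m = 0) ∧
      (∀ f g : R, D f (Q g) - D g (Q f) = Q (pb f g)) := by
  intro Q ⟨Q_add, _, _⟩ ⟨_, hX⟩
  have Q_zero : Q 0 = 0 := by simpa using Q_add 0 0
  have pb_zero (f : R) : pb f 0 = 0 := by
    simpa [pb_skew f 0] using pb_add 0 0 f
  have lb_zero_left (m : M) : lb 0 m = 0 := by simpa using lb_add 0 0 m
  have lb_zero_right (m : M) : lb m 0 = 0 := by simp [lb_skew m 0, lb_zero_left]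
  have D_zero_left (m : M) : D 0 m = 0 := by simpa using D_add_left 0 0 m
  have D_zero_right (f : R) : D f 0 = 0 := by simpa using D_add_right f 0 0
  have K_zero_left (f : R) : K 0 f = 0 := by simpa using K_add 0 0 f
  have K_zero_right (f : R) : K f 0 = 0 := by simp [K_skew f 0, K_zero_left]
  constructor
  · intro f m
    have h := congrArg Prod.snd (hX (f, 0) (0, m))
    simpa [abr, pb_zero, Q_zero, lb_zero_left, D_zero_left, D_zero_right, K_zero_left,
      K_zero_right] using h.symm
  · intro f g
    have h := congrArg Prod.snd (hX (f, 0) (g, 0))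
    simp only [abr, lb_zero_left, lb_zero_right, D_zero_left, K_zero_left, K_zero_right,
      Prod.snd_add] at h
    rw [h]
    abel
end
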